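/- arXiv:0909.3802 — 3 statements merged into one kernel-verified Lean document; each statement's English description precedes it below -/
import Mathlib

section
/- Let n, s, p be integers with s ≥ 2, let m_1 ≥ m_2 ≥ … ≥ m_s ≥ 0 with m_1 + m_2 < n, and let r = 2p be an even integer with 1 ≤ r ≤ 2n − 2m_1. Assume 2·[C(n+2,2) − C(n+2−r,2)] ≤ 2·Σ_{i : m_i ≤ p−1} C(m_i+2,2) + p·Σ_{i : m_i ≥ p} (2m_i + 3 − p). Then there exist subspaces W_1, …, W_s of ℂ^{n+1} with dim W_i = m_i + 1 such that no quadratic form of rank exactly r vanishes identically on every W_i, i.e. Q(W_1,…,W_s) contains no rank r quadric. -/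
/-- The rank of a quadratic form `q` on `ℂ^{n+1}`: `n+1` minus the dimension of the
radical of its polar bilinear form. -/
noncomputable def quadRank (n : ℕ) (q : QuadraticForm ℂ (Fin (n + 1) → ℂ)) : ℕ :=
  (n + 1) - Module.finrank ℂ (LinearMap.ker (QuadraticMap.polarBilin q))

open IntermediateField in
/-- algebraic closure inside ℂ of the field generated by `T`. -/
noncomputable def acl (T : Set ℂ) : IntermediateField ℚ ℂ :=
  (algebraicClosure (IntermediateField.adjoin ℚ T) ℂ).restrictScalars ℚ

lemma mem_acl {T : Set ℂ} {x : ℂ} :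
    x ∈ acl T ↔ IsAlgebraic (IntermediateField.adjoin ℚ T) x := by
  unfold acl
  rw [IntermediateField.mem_restrictScalars, mem_algebraicClosure_iff]

lemma mem_acl_iff_closure {T : Set ℂ} {x : ℂ} :
    x ∈ acl T ↔ x ∈ (AlgebraicIndependent.matroid ℚ ℂ).closure T := by
  rw [mem_acl, AlgebraicIndependent.matroid_closure_eq, SetLike.mem_coe,
    Subalgebra.mem_algebraicClosure, IntermediateField.isAlgebraic_adjoin_iff]

lemma subset_acl (T : Set ℂ) : T ⊆ acl T := fun x hx => by
  rw [SetLike.mem_coe, mem_acl_iff_closure]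
  exact Matroid.mem_closure_of_mem' _ hx

lemma acl_le {T T' : Set ℂ} (h : T ⊆ acl T') : acl T ≤ acl T' := fun x hx => by
  rw [mem_acl_iff_closure] at hx ⊢
  refine Matroid.closure_subset_closure_of_subset_closure ?_ hx
  intro y hy
  exact mem_acl_iff_closure.1 (h hy)

lemma acl_mono {T T' : Set ℂ} (h : T ⊆ T') : acl T ≤ acl T' :=
  acl_le (h.trans (subset_acl T'))

lemma acl_root {T : Set ℂ} {a b c t : ℂ} (ha : a ∈ acl T) (hb : b ∈ acl T) (hc : c ∈ acl T)
    (h0 : a ≠ 0) (h : a * t ^ 2 + b * t + c = 0) : t ∈ acl T := by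
  have h1 : IsAlgebraic (algebraicClosure (IntermediateField.adjoin ℚ T) ℂ) t := by
    let a' : algebraicClosure (IntermediateField.adjoin ℚ T) ℂ := ⟨a, ha⟩
    let b' : algebraicClosure (IntermediateField.adjoin ℚ T) ℂ := ⟨b, hb⟩
    let c' : algebraicClosure (IntermediateField.adjoin ℚ T) ℂ := ⟨c, hc⟩
    refine ⟨Polynomial.C a' * Polynomial.X ^ 2 + Polynomial.C b' * Polynomial.X + Polynomial.C c',
      ?_, ?_⟩
    · intro hp
      have := congrArg (fun p => Polynomial.coeff p 2) hp
      simp at this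
      exact h0 (congrArg Subtype.val this)
    · simpa [a', b', c', Algebra.algebraMap_eq_smul_one, IntermediateField.smul_def] using h
  exact mem_acl.2 (IsAlgebraic.restrictScalars (IntermediateField.adjoin ℚ T) h1)

lemma acl_count {ι : Type*} {x : ι → ℂ} (hx : AlgebraicIndependent ℚ x) (J : Finset ι)
    (T : Finset ℂ) (h : ∀ j ∈ J, x j ∈ acl (T : Set ℂ)) : J.card ≤ T.card := by
  classical
  have hI : (AlgebraicIndependent.matroid ℚ ℂ).Indep (Set.range x) := by
    rw [AlgebraicIndependent.matroid_indep_iff]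
    exact hx.coe_range
  have hJ := hI.subset (Set.image_subset_range x (J : Set ι))
  have h1 : x '' (J : Set ι) ⊆ (AlgebraicIndependent.matroid ℚ ℂ).closure (T : Set ℂ) := by
    rintro _ ⟨j, hj, rfl⟩
    exact mem_acl_iff_closure.1 (h j hj)
  have h2 := hJ.encard_le_eRk_of_subset h1
  rw [Matroid.eRk_closure_eq] at h2
  have h3 := h2.trans (Matroid.eRk_le_encard _ _)
  rw [hx.injective.injOn.encard_image] at h3
  simpa using h3

lemma exists_generic (ι : Type) [Countable ι] : ∃ x : ι → ℂ, AlgebraicIndependent ℚ x := by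
  obtain ⟨s, hs⟩ := exists_isTranscendenceBasis ℚ ℂ
  have h := IsAlgClosed.cardinal_eq_cardinal_transcendence_basis_of_aleph0_lt' _ hs
    (by simp) (by simp [Cardinal.mk_complex, Cardinal.aleph0_lt_continuum])
  have h2 : Cardinal.mk ι ≤ Cardinal.mk s := by
    rw [← h]
    exact (Cardinal.mk_le_aleph0).trans (by simp [Cardinal.mk_complex, Cardinal.aleph0_le_continuum])
  obtain ⟨f⟩ := h2
  exact ⟨fun i => (f i : ℂ), hs.1.comp f f.injective⟩

open Matrix in
lemma ker_basis (F : IntermediateField ℚ ℂ) {d N : ℕ} (A : Matrix (Fin d) (Fin N) ℂ)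
    (hA : ∀ i j, A i j ∈ F) (hind : LinearIndependent ℂ A.row) :
    ∃ L : Fin (N - d) → Fin N → ℂ, (∀ a j, L a j ∈ F) ∧
      (∀ v, A *ᵥ v = 0 → ∃ t : Fin (N - d) → ℂ, v = ∑ a, t a • L a) ∧
      ∀ a, A *ᵥ L a = 0 := by
  classical
  let A' : Matrix (Fin d) (Fin N) F := fun i j => ⟨A i j, hA i j⟩
  have hA' : A = A'.map (algebraMap F ℂ) := by ext; rfl
  have hind' : LinearIndependent F A'.row := by
    rw [← linearIndependent_algebraMap_comp_iff (S := ℂ)]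
    exact hind
  have hr : A.rank = d := by rw [hind.rank_matrix]; simp
  have hr' : A'.rank = d := by rw [hind'.rank_matrix]; simp
  have hk : Module.finrank ℂ (LinearMap.ker A.mulVecLin) = N - d := by
    have := LinearMap.finrank_range_add_finrank_ker A.mulVecLin
    rw [Matrix.rank] at hr
    simp at this
    omega
  have hk' : Module.finrank F (LinearMap.ker A'.mulVecLin) = N - d := by
    have := LinearMap.finrank_range_add_finrank_ker A'.mulVecLin
    rw [Matrix.rank] at hr'
    simp at this
    omega
  let b := Module.finBasisOfFinrankEq F _ hk'
  let L' : Fin (N - d) → Fin N → F := fun a => (b a : Fin N → F)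
  have hL'ind : LinearIndependent F L' :=
    b.linearIndependent.map' (Submodule.subtype _) (Submodule.ker_subtype _)
  let L : Fin (N - d) → Fin N → ℂ := fun a => algebraMap F ℂ ∘ L' a
  have hLind : LinearIndependent ℂ L := linearIndependent_algebraMap_comp_iff.2 hL'ind
  have hLker : ∀ a, A *ᵥ L a = 0 := by
    intro a
    have h1 : A' *ᵥ L' a = 0 := LinearMap.mem_ker.1 (b a).2
    ext i
    have h2 := congrArg (algebraMap F ℂ) (congrFun h1 i)
    rw [hA']
    simpa [Matrix.mulVec, dotProduct, L] using h2
  refine ⟨L, fun a j => (L' a j).2, ?_, hLker⟩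
  have hspan : Submodule.span ℂ (Set.range L) = LinearMap.ker A.mulVecLin := by
    apply Submodule.eq_of_le_of_finrank_eq
    · rw [Submodule.span_le]
      rintro _ ⟨a, rfl⟩
      simpa using hLker a
    · rw [finrank_span_eq_card hLind, hk]; simp
  intro v hv
  have : v ∈ Submodule.span ℂ (Set.range L) := by rw [hspan]; simpa using hv
  obtain ⟨t, ht⟩ := (Submodule.mem_span_range_iff_exists_fun ℂ).1 this
  exact ⟨t, ht.symm⟩

/-- A nonzero quadratic relation over `acl T` among `e` numbers lowers the number of parameters. -/
lemma quad_step (T : Set ℂ) {e : ℕ} (Q : Fin e → Fin e → ℂ) (hQ : ∀ a b, Q a b ∈ acl T)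
    (hsym : ∀ a b, Q a b = Q b a) (hne : ∃ a b, Q a b ≠ 0) (t : Fin e → ℂ)
    (h : ∑ a, ∑ b, t a * t b * Q a b = 0) :
    ∃ T' : Finset ℂ, T'.card + 1 ≤ e ∧ ∀ a, t a ∈ acl (T ∪ T') := by
  classical
  suffices H : ∃ a0, t a0 ∈ acl (T ∪ ((Finset.univ.erase a0).image t : Finset ℂ)) by
    obtain ⟨a0, h0⟩ := H
    refine ⟨(Finset.univ.erase a0).image t, ?_, ?_⟩
    · have h1 := Finset.card_image_le (s := Finset.univ.erase a0) (f := t)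
      rw [Finset.card_erase_of_mem (Finset.mem_univ _)] at h1
      have : 0 < e := a0.pos
      simp at h1 ⊢
      omega
    · intro a
      by_cases ha : a = a0
      · exact ha ▸ h0
      · apply subset_acl
        right
        simp only [Finset.coe_image]
        exact ⟨a, by simp [ha], rfl⟩
  have hmem : ∀ a0 b, b ≠ a0 → t b ∈ acl (T ∪ ((Finset.univ.erase a0).image t : Finset ℂ)) := by
    intro a0 b hb
    apply subset_acl
    right
    simp only [Finset.coe_image]
    exact ⟨b, by simp [hb], rfl⟩
  have hQ' : ∀ a0 a b, Q a b ∈ acl (T ∪ ((Finset.univ.erase a0).image t : Finset ℂ)) :=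
    fun a0 a b => acl_mono Set.subset_union_left (hQ a b)
  -- expansion of the relation with respect to one variable
  have hexp : ∀ a0, Q a0 a0 * t a0 ^ 2 + (2 * ∑ b ∈ Finset.univ.erase a0, t b * Q a0 b) * t a0 +
      ∑ a ∈ Finset.univ.erase a0, ∑ b ∈ Finset.univ.erase a0, t a * t b * Q a b = 0 := by
    intro a0
    rw [← h]
    have e1 : ∀ a, ∑ b, t a * t b * Q a b =
        t a * t a0 * Q a a0 + ∑ b ∈ Finset.univ.erase a0, t a * t b * Q a b := fun a =>
      (Finset.add_sum_erase _ _ (Finset.mem_univ a0)).symm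
    simp_rw [e1]
    rw [← Finset.add_sum_erase _ _ (Finset.mem_univ a0), Finset.sum_add_distrib]
    have e2 : ∑ a ∈ Finset.univ.erase a0, t a * t a0 * Q a a0 =
        t a0 * ∑ b ∈ Finset.univ.erase a0, t b * Q a0 b := by
      rw [Finset.mul_sum]
      exact Finset.sum_congr rfl fun a _ => by rw [hsym a a0]; ring
    have e3 : ∑ b ∈ Finset.univ.erase a0, t a0 * t b * Q a0 b =
        t a0 * ∑ b ∈ Finset.univ.erase a0, t b * Q a0 b := by
      rw [Finset.mul_sum]
      exact Finset.sum_congr rfl fun a _ => by ring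
    rw [e2, e3]
    ring
  have hlin : ∀ a0, ∑ b ∈ Finset.univ.erase a0, t b * Q a0 b ∈
      acl (T ∪ ((Finset.univ.erase a0).image t : Finset ℂ)) := fun a0 =>
    sum_mem fun b hb => mul_mem (hmem a0 b (Finset.ne_of_mem_erase hb)) (hQ' a0 _ _)
  have hcst : ∀ a0, ∑ a ∈ Finset.univ.erase a0, ∑ b ∈ Finset.univ.erase a0, t a * t b * Q a b ∈
      acl (T ∪ ((Finset.univ.erase a0).image t : Finset ℂ)) := fun a0 =>
    sum_mem fun a ha => sum_mem fun b hb =>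
      mul_mem (mul_mem (hmem a0 a (Finset.ne_of_mem_erase ha))
        (hmem a0 b (Finset.ne_of_mem_erase hb))) (hQ' a0 _ _)
  have htwo : ∀ a0, (2 : ℂ) ∈ acl (T ∪ ((Finset.univ.erase a0).image t : Finset ℂ)) :=
    fun a0 => ofNat_mem _ 2
  by_cases hd : ∃ a0, Q a0 a0 ≠ 0
  · obtain ⟨a0, ha0⟩ := hd
    exact ⟨a0, acl_root (hQ' a0 a0 a0) (mul_mem (htwo a0) (hlin a0)) (hcst a0) ha0 (hexp a0)⟩
  · push Not at hd
    obtain ⟨a0, b0, hab⟩ := hne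
    have hne : b0 ≠ a0 := by rintro rfl; exact hab (hd _)
    by_cases hz : ∑ b ∈ Finset.univ.erase a0, t b * Q a0 b = 0
    · refine ⟨b0, ?_⟩
      rw [← Finset.add_sum_erase _ _ (Finset.mem_erase.2 ⟨hne, Finset.mem_univ b0⟩)] at hz
      have : t b0 = -(∑ b ∈ (Finset.univ.erase a0).erase b0, t b * Q a0 b) / Q a0 b0 := by
        field_simp
        linear_combination hz
      rw [this]
      refine div_mem (neg_mem (sum_mem fun b hb => mul_mem (hmem b0 b ?_) (hQ' _ _ _))) (hQ' _ _ _)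
      exact Finset.ne_of_mem_erase hb
    · refine ⟨a0, ?_⟩
      have h1 := hexp a0
      rw [hd a0] at h1
      set l := ∑ b ∈ Finset.univ.erase a0, t b * Q a0 b with hl
      have : t a0 = -(∑ a ∈ Finset.univ.erase a0, ∑ b ∈ Finset.univ.erase a0,
          t a * t b * Q a b) / (2 * l) := by
        field_simp
        linear_combination h1
      rw [this]
      exact div_mem (neg_mem (hcst a0)) (mul_mem (htwo a0) (hlin a0))

open Matrix in
lemma mulVec_mem {F : IntermediateField ℚ ℂ} {N : ℕ} {S : Matrix (Fin N) (Fin N) ℂ}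
    (hS : ∀ i j, S i j ∈ F) {v : Fin N → ℂ} (hv : ∀ j, v j ∈ F) (i : Fin N) : (S *ᵥ v) i ∈ F := by
  rw [Matrix.mulVec, dotProduct]
  exact sum_mem fun j _ => mul_mem (hS i j) (hv j)

open Matrix in
lemma finrank_ker_rows {d N : ℕ} (A : Matrix (Fin d) (Fin N) ℂ)
    (hind : LinearIndependent ℂ A.row) :
    Module.finrank ℂ (LinearMap.ker A.mulVecLin) + d = N := by
  have hr : A.rank = d := by rw [hind.rank_matrix]; simp
  have := LinearMap.finrank_range_add_finrank_ker A.mulVecLin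
  rw [Matrix.rank] at hr
  simp at this
  omega

open Matrix in
lemma rows_basis {N : ℕ} (S : Matrix (Fin N) (Fin N) ℂ) :
    ∃ ρ : Fin S.rank → Fin N, LinearIndependent ℂ (fun a => S.row (ρ a)) ∧
      ∀ j, ∃ c : Fin S.rank → ℂ, S.row j = ∑ a, c a • S.row (ρ a) := by
  have hex := Submodule.exists_fun_fin_finrank_span_eq ℂ (Set.range S.row)
  rw [← Matrix.rank_eq_finrank_span_row] at hex
  obtain ⟨f, hf1, hf2, hf3⟩ := hex
  choose ρ hρ using hf1
  refine ⟨ρ, by simpa only [hρ] using hf3, fun j => ?_⟩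
  have : S.row j ∈ Submodule.span ℂ (Set.range f) := by
    rw [hf2]; exact Submodule.subset_span ⟨j, rfl⟩
  obtain ⟨c, hc⟩ := (Submodule.mem_span_range_iff_exists_fun ℂ).1 this
  exact ⟨c, by simp only [hρ]; exact hc.symm⟩

open Matrix in
lemma symm_dot {N : ℕ} {S : Matrix (Fin N) (Fin N) ℂ} (hS : S.IsSymm) (v w : Fin N → ℂ) :
    (S *ᵥ v) ⬝ᵥ w = v ⬝ᵥ (S *ᵥ w) := by
  rw [dotProduct_mulVec, ← mulVec_transpose, hS.eq]

open Matrix in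
lemma iso_count (T : Set ℂ) {N : ℕ} (S : Matrix (Fin N) (Fin N) ℂ) (hS : S.IsSymm)
    (hST : ∀ i j, S i j ∈ acl T) (v : ℕ → Fin N → ℂ) (k : ℕ)
    (hiso : ∀ i < k, ∀ j < k, v i ⬝ᵥ (S *ᵥ v j) = 0) :
    ∃ (d : ℕ) (u : Fin d → Fin N → ℂ) (T' : Finset ℂ),
      (∀ a, ∃ i < k, u a = v i) ∧ LinearIndependent ℂ (fun a => S *ᵥ u a) ∧
      (∀ i < k, ∀ j, v i j ∈ acl (T ∪ T')) ∧ d ≤ k ∧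
      2 * (T'.card : ℤ) + d * (d + 1) + 2 * (k - d) * (S.rank - d) ≤ 2 * N * k := by
  classical
  induction k with
  | zero =>
    refine ⟨0, Fin.elim0, ∅, fun a => a.elim0, linearIndependent_empty_type, ?_, le_rfl, by simp⟩
    intro i hi; omega
  | succ k ih =>
    obtain ⟨d, u, T', hu, hind, hv, hdk, hb⟩ :=
      ih (fun i hi j hj => hiso i (by omega) j (by omega))
    have hrN : S.rank ≤ N := by simpa using S.rank_le_width
    have huF : ∀ a j, u a j ∈ acl (T ∪ T') := by
      intro a j
      obtain ⟨i, hi, e⟩ := hu a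
      rw [e]; exact hv i hi j
    have hSF : ∀ i j, S i j ∈ acl (T ∪ T') := fun i j => acl_mono Set.subset_union_left (hST i j)
    by_cases hA : S *ᵥ v k ∈ Submodule.span ℂ (Set.range fun a => S *ᵥ u a)
    · obtain ⟨c, hc⟩ := (Submodule.mem_span_range_iff_exists_fun ℂ).1 hA
      obtain ⟨ρ, hρ, hρ2⟩ := rows_basis S
      obtain ⟨L, hLF, hL, -⟩ := ker_basis (acl (T ∪ T'))
        (Matrix.of fun a => S.row (ρ a)) (fun a j => hSF _ _) hρ
      obtain ⟨t, ht⟩ := hL (v k - ∑ a, c a • u a) (by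
        have h0 : S *ᵥ (v k - ∑ a, c a • u a) = 0 := by
          rw [mulVec_sub, mulVec_sum, ← hc]
          simp [mulVec_smul]
        ext a
        exact congrFun h0 (ρ a))
      have hsub : T ∪ (T' : Set ℂ) ⊆
          T ∪ ((T' ∪ Finset.univ.image c ∪ Finset.univ.image t : Finset ℂ) : Set ℂ) := by
        intro x; simp; tauto
      refine ⟨d, u, T' ∪ Finset.univ.image c ∪ Finset.univ.image t, ?_, hind, ?_, by omega, ?_⟩
      · intro a
        obtain ⟨i, hi, e⟩ := hu a
        exact ⟨i, by omega, e⟩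
      · intro i hi j
        by_cases hik : i = k
        · have hvk : v i = ∑ a, c a • u a + ∑ a, t a • L a := by rw [← ht, hik]; simp
          rw [hvk]
          simp only [Pi.add_apply, Finset.sum_apply, Pi.smul_apply, smul_eq_mul]
          refine add_mem (sum_mem fun a _ => mul_mem (subset_acl _ ?_) (acl_mono hsub (huF a j)))
            (sum_mem fun a _ => mul_mem (subset_acl _ ?_) (acl_mono hsub (hLF a j)))
          · simp
          · simp
        · exact acl_mono hsub (hv i (by omega) j)
      · have h1 : (T' ∪ Finset.univ.image c ∪ Finset.univ.image t).card ≤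
            T'.card + d + (N - S.rank) := by
          refine (Finset.card_union_le _ _).trans (add_le_add ((Finset.card_union_le _ _).trans
            (add_le_add le_rfl ?_)) ?_)
          · simpa using Finset.card_image_le (s := Finset.univ) (f := c)
          · simpa using Finset.card_image_le (s := Finset.univ) (f := t)
        zify [hrN] at h1
        push_cast
        nlinarith
    · have hind2 : LinearIndependent ℂ (fun a => S *ᵥ (Fin.snoc u (v k) : Fin (d+1) → _) a) := by
        have := linearIndependent_finSnoc.2 ⟨hind, hA⟩
        have e : (fun a => S *ᵥ (Fin.snoc u (v k) : Fin (d+1) → _) a) =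
            Fin.snoc (fun a => S *ᵥ u a) (S *ᵥ v k) := by
          funext a
          refine Fin.lastCases ?_ (fun a => ?_) a <;> simp
        rw [e]
        exact this
      have hu' : ∀ a, ∃ i < k + 1, (Fin.snoc u (v k) : Fin (d+1) → _) a = v i := by
        intro a
        refine Fin.lastCases ?_ (fun a => ?_) a
        · exact ⟨k, by omega, by simp⟩
        · obtain ⟨i, hi, e⟩ := hu a
          exact ⟨i, by omega, by simpa using e⟩
      let A : Matrix (Fin d) (Fin N) ℂ := Matrix.of fun a => S *ᵥ u a
      have hAF : ∀ a j, A a j ∈ acl (T ∪ T') := fun a j =>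
        mulVec_mem hSF (huF a) j
      obtain ⟨L, hLF, hL, hL2⟩ := ker_basis (acl (T ∪ T')) A hAF hind
      obtain ⟨t, ht⟩ := hL (v k) (by
        ext a
        change (S *ᵥ u a) ⬝ᵥ v k = 0
        rw [symm_dot hS]
        obtain ⟨i, hi, e⟩ := hu a
        rw [e]
        exact hiso i (by omega) k (by omega))
      have hbil : ∀ t t' : Fin (N - d) → ℂ, (∑ a, t a • L a) ⬝ᵥ (S *ᵥ (∑ a, t' a • L a)) =
          ∑ a, ∑ b, t a * t' b * (L a ⬝ᵥ (S *ᵥ L b)) := by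
        intro t t'
        rw [mulVec_sum, sum_dotProduct]
        refine Finset.sum_congr rfl fun a _ => ?_
        rw [dotProduct_sum]
        refine Finset.sum_congr rfl fun b _ => ?_
        rw [mulVec_smul, smul_dotProduct, dotProduct_smul, smul_eq_mul, smul_eq_mul, mul_assoc]
      have hQne : ∃ a b, L a ⬝ᵥ (S *ᵥ L b) ≠ 0 := by
        by_contra hcon
        push Not at hcon
        let A2 : Matrix (Fin (d + 1)) (Fin N) ℂ :=
          Matrix.of fun a => S *ᵥ (Fin.snoc u (v k) : Fin (d+1) → _) a
        have h1 := finrank_ker_rows A hind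
        have h2 := finrank_ker_rows A2 hind2
        have hle : LinearMap.ker A.mulVecLin ≤ LinearMap.ker A2.mulVecLin := by
          intro w hw
          rw [LinearMap.mem_ker, mulVecLin_apply] at hw ⊢
          ext a
          refine Fin.lastCases ?_ (fun a => ?_) a
          · change (S *ᵥ (Fin.snoc u (v k) : Fin (d+1) → _) (Fin.last d)) ⬝ᵥ w = 0
            rw [Fin.snoc_last, symm_dot hS]
            obtain ⟨t', ht'⟩ := hL w hw
            rw [ht', ht, hbil]
            simp [hcon]
          · change (S *ᵥ (Fin.snoc u (v k) : Fin (d+1) → _) a.castSucc) ⬝ᵥ w = 0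
            rw [Fin.snoc_castSucc]
            exact congrFun hw a
        have := Submodule.finrank_mono hle
        omega
      obtain ⟨T2, hT2, htT⟩ := quad_step (T ∪ T') (fun a b => L a ⬝ᵥ (S *ᵥ L b))
        (fun a b => sum_mem fun i _ => mul_mem (hLF _ _)
          (mulVec_mem hSF (hLF b) i))
        (fun a b => by rw [← symm_dot hS, dotProduct_comm]) hQne t
        (by rw [← hbil, ← ht]; exact hiso k (by omega) k (by omega))
      have heq : T ∪ (T' : Set ℂ) ∪ T2 = T ∪ ((T' ∪ T2 : Finset ℂ) : Set ℂ) := by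
        rw [Finset.coe_union, Set.union_assoc]
      rw [heq] at htT
      have hsub : T ∪ (T' : Set ℂ) ⊆ T ∪ ((T' ∪ T2 : Finset ℂ) : Set ℂ) := by
        rw [← heq]; exact Set.subset_union_left
      refine ⟨d + 1, Fin.snoc u (v k), T' ∪ T2, hu', hind2, ?_, by omega, ?_⟩
      · intro i hi j
        by_cases hik : i = k
        · rw [hik, ht]
          simp only [Finset.sum_apply, Pi.smul_apply, smul_eq_mul]
          exact sum_mem fun a _ => mul_mem (htT a) (acl_mono hsub (hLF a j))
        · exact acl_mono hsub (hv i (by omega) j)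
      · have h1 := Finset.card_union_le T' T2
        have h2 : T2.card + 1 + d ≤ N := by omega
        zify at h1 h2 hdk
        push_cast
        nlinarith

open Matrix in
/-- An isotropic independent family modulo the radical has at most `rank / 2` members. -/
lemma iso_le {N d : ℕ} (S : Matrix (Fin N) (Fin N) ℂ) (hS : S.IsSymm)
    (u : Fin d → Fin N → ℂ) (hind : LinearIndependent ℂ (fun a => S *ᵥ u a))
    (hiso : ∀ a b, u a ⬝ᵥ (S *ᵥ u b) = 0) : 2 * d ≤ S.rank := by
  let A : Matrix (Fin d) (Fin N) ℂ := Matrix.of fun a => S *ᵥ u a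
  have h1 := finrank_ker_rows A hind
  have hu : LinearIndependent ℂ u := by
    have : LinearIndependent ℂ (S.mulVecLin ∘ u) := hind
    exact this.of_comp
  have h2 : Module.finrank ℂ (Submodule.span ℂ (Set.range u)) = d := by
    rw [finrank_span_eq_card hu]; simp
  have h3 : S.rank + Module.finrank ℂ (LinearMap.ker S.mulVecLin) = N := by
    have := LinearMap.finrank_range_add_finrank_ker S.mulVecLin
    rw [Matrix.rank]
    simpa using this
  have hle : Submodule.span ℂ (Set.range u) ⊔ LinearMap.ker S.mulVecLin ≤
      LinearMap.ker A.mulVecLin := by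
    refine sup_le (Submodule.span_le.2 ?_) ?_
    · rintro _ ⟨b, rfl⟩
      rw [SetLike.mem_coe, LinearMap.mem_ker, mulVecLin_apply]
      ext a
      change (S *ᵥ u a) ⬝ᵥ u b = 0
      rw [symm_dot hS, hiso]
    · intro w hw
      rw [LinearMap.mem_ker, mulVecLin_apply] at hw ⊢
      ext a
      change (S *ᵥ u a) ⬝ᵥ w = 0
      rw [symm_dot hS, hw, dotProduct_zero]
  have hinf : Submodule.span ℂ (Set.range u) ⊓ LinearMap.ker S.mulVecLin = ⊥ := by
    have hd : Disjoint (Submodule.span ℂ (Set.range u)) (LinearMap.ker S.mulVecLin) := by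
      rw [Submodule.disjoint_def]
      intro w hw hk
      obtain ⟨c, rfl⟩ := (Submodule.mem_span_range_iff_exists_fun ℂ).1 hw
      rw [LinearMap.mem_ker, mulVecLin_apply, mulVec_sum] at hk
      simp only [mulVec_smul] at hk
      have := Fintype.linearIndependent_iff.1 hind c hk
      simp [this]
    exact hd.eq_bot
  have h4 := Submodule.finrank_sup_add_finrank_inf_eq (Submodule.span ℂ (Set.range u))
    (LinearMap.ker S.mulVecLin)
  rw [hinf, finrank_bot] at h4
  have h5 := Submodule.finrank_mono hle
  omega

open Matrix in
/-- Up to scaling, a symmetric matrix of rank `r` depends on few parameters. -/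
lemma symm_count {N : ℕ} (S : Matrix (Fin N) (Fin N) ℂ) (hS : S.IsSymm) (hr : 1 ≤ S.rank) :
    ∃ (c : ℂ) (T : Finset ℂ), c ≠ 0 ∧ (∀ i j, (c • S) i j ∈ acl (T : Set ℂ)) ∧
      2 * ((T.card : ℤ) + 1) + S.rank * (S.rank - 1) ≤ 2 * S.rank * N := by
  classical
  obtain ⟨ρ, hρ, hC⟩ := rows_basis S
  choose C hC using hC
  have hrN : S.rank ≤ N := by simpa using S.rank_le_width
  have hinj : Function.Injective ρ := by
    intro a b hab
    exact hρ.injective (by simp only [hab])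
  have hrow : ∀ i j, S i j = ∑ a, C i a * S (ρ a) j := by
    intro i j
    have := congrFun (hC i) j
    simpa [Matrix.row] using this
  have hsym : ∀ i j, S i j = S j i := fun i j => (hS.apply i j).symm
  have hne : ∃ a b, S (ρ a) (ρ b) ≠ 0 := by
    by_contra hcon
    push Not at hcon
    have h1 : ∀ a j, S (ρ a) j = 0 := by
      intro a j
      rw [hsym, hrow]
      simp [hcon]
    have h2 : S = 0 := by
      ext i j
      rw [hrow]
      simp [h1]
    rw [h2] at hr
    simp at hr
  obtain ⟨a0, b0, hab⟩ := hne
  let g : Sym2 (Fin S.rank) → ℂ := Sym2.lift ⟨fun a b => (S (ρ a0) (ρ b0))⁻¹ * S (ρ a) (ρ b),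
    fun a b => congrArg _ (hsym (ρ a) (ρ b))⟩
  let T1 : Finset ℂ := (Finset.univ.erase s(a0, b0)).image g
  let T2 : Finset ℂ := ((Finset.univ \ Finset.univ.image ρ) ×ˢ
    (Finset.univ : Finset (Fin S.rank))).image fun x => C x.1 x.2
  have hT1 : T1.card + 1 ≤ (S.rank + 1).choose 2 := by
    have h1 : T1.card ≤ _ := Finset.card_image_le
    rw [Finset.card_erase_of_mem (Finset.mem_univ _), Finset.card_univ, Sym2.card,
      Fintype.card_fin] at h1
    have : 0 < (S.rank + 1).choose 2 := Nat.choose_pos (by omega)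
    omega
  have hT2 : T2.card ≤ (N - S.rank) * S.rank := by
    have h1 : T2.card ≤ _ := Finset.card_image_le
    rw [Finset.card_product, Finset.card_sdiff_of_subset (Finset.subset_univ _),
      Finset.card_image_of_injective _ hinj] at h1
    simpa using h1
  have hmem2 : ∀ i ∉ Set.range ρ, ∀ a, C i a ∈ acl ((T1 ∪ T2 : Finset ℂ) : Set ℂ) := by
    intro i hi a
    apply subset_acl
    rw [Finset.mem_coe]
    apply Finset.mem_union_right
    refine Finset.mem_image.2 ⟨(i, a), ?_, rfl⟩
    simpa using hi
  have hmem1 : ∀ a b, (S (ρ a0) (ρ b0))⁻¹ * S (ρ a) (ρ b) ∈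
      acl ((T1 ∪ T2 : Finset ℂ) : Set ℂ) := by
    intro a b
    by_cases h : s(a, b) = s(a0, b0)
    · have h1 : g s(a, b) = g s(a0, b0) := by rw [h]
      have h2 : (S (ρ a0) (ρ b0))⁻¹ * S (ρ a) (ρ b) = (S (ρ a0) (ρ b0))⁻¹ * S (ρ a0) (ρ b0) := h1
      rw [h2, inv_mul_cancel₀ hab]
      exact one_mem _
    · apply subset_acl
      rw [Finset.mem_coe]
      apply Finset.mem_union_left
      exact Finset.mem_image.2 ⟨s(a, b), by simpa using h, rfl⟩
  have hmem3 : ∀ a j, (S (ρ a0) (ρ b0))⁻¹ * S (ρ a) j ∈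
      acl ((T1 ∪ T2 : Finset ℂ) : Set ℂ) := by
    intro a j
    by_cases hj : j ∈ Set.range ρ
    · obtain ⟨b, rfl⟩ := hj
      exact hmem1 a b
    · rw [hsym (ρ a) j, hrow j (ρ a), Finset.mul_sum]
      refine sum_mem fun b _ => ?_
      rw [mul_left_comm]
      exact mul_mem (hmem2 j hj b) (hmem1 b a)
  refine ⟨(S (ρ a0) (ρ b0))⁻¹, T1 ∪ T2, inv_ne_zero hab, ?_, ?_⟩
  · intro i j
    change (S (ρ a0) (ρ b0))⁻¹ * S i j ∈ _
    by_cases hi : i ∈ Set.range ρ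
    · obtain ⟨b, rfl⟩ := hi
      exact hmem3 b j
    · rw [hrow i j, Finset.mul_sum]
      refine sum_mem fun b _ => ?_
      rw [mul_left_comm]
      exact mul_mem (hmem2 i hi b) (hmem3 b j)
  · have h1 := Finset.card_union_le T1 T2
    have h2 : 2 * (S.rank + 1).choose 2 = (S.rank + 1) * S.rank := by
      rw [Nat.choose_two_right, Nat.add_sub_cancel, Nat.mul_div_cancel']
      rw [mul_comm]; exact (Nat.even_mul_succ_self S.rank).two_dvd
    zify [hrN] at h1 h2 hT1 hT2
    nlinarith

/-- Twice the codimension of isotropic `k`-spaces with respect to a form of rank `2p`, `k = m+1`. -/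
def codim2 (p m : ℕ) : ℕ := if m < p then 2 * (m + 2).choose 2 else p * (2 * m + 3 - p)

open Matrix in
lemma iso_final (T : Set ℂ) {N p : ℕ} (S : Matrix (Fin N) (Fin N) ℂ) (hS : S.IsSymm)
    (hp : S.rank = 2 * p)
    (hST : ∀ i j, S i j ∈ acl T) (v : ℕ → Fin N → ℂ) (m : ℕ)
    (hiso : ∀ i < m + 1, ∀ j < m + 1, v i ⬝ᵥ (S *ᵥ v j) = 0) :
    ∃ T' : Finset ℂ, (∀ i < m + 1, ∀ j, v i j ∈ acl (T ∪ T')) ∧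
      2 * T'.card + codim2 p m ≤ 2 * (N * (m + 1)) := by
  obtain ⟨d, u, T', hu, hind, hv, hdk, hb⟩ := iso_count T S hS hST v (m + 1) hiso
  refine ⟨T', hv, ?_⟩
  have hd : 2 * d ≤ S.rank := by
    refine iso_le S hS u hind fun a b => ?_
    obtain ⟨i, hi, e⟩ := hu a
    obtain ⟨j, hj, e'⟩ := hu b
    rw [e, e']
    exact hiso i hi j hj
  rw [hp] at hd hb
  have hdp : d ≤ p := by omega
  unfold codim2
  split_ifs with hm
  · have h2 : 2 * (m + 2).choose 2 = (m + 2) * (m + 1) := by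
      rw [Nat.choose_two_right, Nat.mul_div_cancel']
      · rfl
      · rw [mul_comm]; exact (Nat.even_mul_succ_self (m + 1)).two_dvd
    rw [h2]
    rcases hdk.lt_or_eq with hlt | heq
    · zify at hlt hm hdk hdp ⊢
      push_cast at hb hdk hlt
      have h3 : (0 : ℤ) ≤ (m + 1 - d) * (4 * p - 3 * d - m - 2) :=
        mul_nonneg (by linarith) (by linarith)
      nlinarith
    · subst heq
      zify
      push_cast at hb
      nlinarith
  · have h3 : p ≤ 2 * m + 3 := by omega
    push Not at hm
    zify [h3] at hm hdk hdp ⊢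
    push_cast at hb hdk
    have h4 : (0 : ℤ) ≤ (p - d) * (m - p) := mul_nonneg (by linarith) (by linarith)
    have h5 : (0 : ℤ) ≤ (p - d) * (p - d) := mul_nonneg (by linarith) (by linarith)
    nlinarith

open Matrix in
lemma form_matrix (n : ℕ) (q : QuadraticForm ℂ (Fin (n + 1) → ℂ)) :
    ∃ S : Matrix (Fin (n + 1)) (Fin (n + 1)) ℂ, S.IsSymm ∧ S.rank = quadRank n q ∧
      ∀ v w, v ⬝ᵥ (S *ᵥ w) = QuadraticMap.polar q v w := by
  classical
  let S := LinearMap.toMatrix₂' ℂ (QuadraticMap.polarBilin q)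
  have hdot : ∀ v w, v ⬝ᵥ (S *ᵥ w) = QuadraticMap.polar q v w := by
    intro v w
    rw [← Matrix.toLinearMap₂'_apply']
    simp [S]
  have hsym : S.IsSymm := by
    ext i j
    simp [S, LinearMap.toMatrix₂'_apply, QuadraticMap.polar_comm]
  refine ⟨S, hsym, ?_, hdot⟩
  have hker : LinearMap.ker (QuadraticMap.polarBilin q) = LinearMap.ker S.mulVecLin := by
    ext w
    rw [LinearMap.mem_ker, LinearMap.mem_ker, mulVecLin_apply]
    constructor
    · intro h
      have h1 : ∀ v, v ⬝ᵥ (S *ᵥ w) = 0 := by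
        intro v
        rw [hdot, QuadraticMap.polar_comm]
        exact LinearMap.congr_fun h v
      exact dotProduct_eq_zero _ fun v => by rw [dotProduct_comm]; exact h1 v
    · intro h
      refine LinearMap.ext fun v => ?_
      rw [QuadraticMap.polarBilin_apply_apply, QuadraticMap.polar_comm, ← hdot, h]
      simp
  have := LinearMap.finrank_range_add_finrank_ker S.mulVecLin
  unfold quadRank
  rw [hker, Matrix.rank]
  simp at this
  omega

open Matrix in
lemma generic_indep {ι : Type} {N k : ℕ} (hk : k ≤ N) (x : ι → ℂ) (hx : AlgebraicIndependent ℚ x)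
    (f : Fin N × Fin N → ι) (hf : Function.Injective f) :
    LinearIndependent ℂ (fun (i : Fin k) (j : Fin N) => x (f (Fin.castLE hk i, j))) := by
  classical
  have hy := hx.comp f hf
  have hdet : (Matrix.of fun i j => x (f (i, j))).det ≠ 0 := by
    intro h0
    have h1 : MvPolynomial.aeval (x ∘ f) (Matrix.mvPolynomialX (Fin N) (Fin N) ℚ).det = 0 := by
      rw [AlgHom.map_det, ← h0]
      congr 1
      ext i j
      simp
    have := hy.eq_zero_of_aeval_eq_zero _ h1
    exact Matrix.det_mvPolynomialX_ne_zero (Fin N) ℚ this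
  have h2 : LinearIndependent ℂ (Matrix.of fun i j => x (f (i, j))).row := by
    rw [Matrix.linearIndependent_rows_iff_isUnit, Matrix.isUnit_iff_isUnit_det]
    exact isUnit_iff_ne_zero.2 hdet
  exact h2.comp (Fin.castLE hk) (Fin.castLE_injective hk)

/-- Rank-exclusion lemma, even rank case: under the stated numerical inequality, a generic
configuration of linear spaces of weight vector `(m_1, …, m_s)` lies on no quadric of
rank `r = 2p`. (`m` is 1-indexed: the components are `m 1, …, m s`.) -/
theorem stmt1 (n s p r : ℕ) (m : ℕ → ℕ) (hs : 2 ≤ s)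
    (hmono : ∀ i j, 1 ≤ i → i ≤ j → j ≤ s → m j ≤ m i)
    (h12 : m 1 + m 2 < n)
    (hr : r = 2 * p) (hr1 : 1 ≤ r) (hr2 : r ≤ 2 * n - 2 * m 1)
    (hineq : 2 * ((n + 2).choose 2 - (n + 2 - r).choose 2) ≤
      2 * ∑ i ∈ (Finset.Icc 1 s).filter (fun i => m i < p), (m i + 2).choose 2
        + p * ∑ i ∈ (Finset.Icc 1 s).filter (fun i => p ≤ m i), (2 * m i + 3 - p)) :
    ∃ W : ℕ → Submodule ℂ (Fin (n + 1) → ℂ),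
      (∀ i ∈ Finset.Icc 1 s, Module.finrank ℂ (W i) = m i + 1) ∧
      ¬ ∃ q : QuadraticForm ℂ (Fin (n + 1) → ℂ),
          quadRank n q = r ∧ ∀ i ∈ Finset.Icc 1 s, ∀ v ∈ W i, q v = 0 := by
  classical
  obtain ⟨x, hx⟩ := exists_generic (Σ _ : ℕ, ℕ × Fin (n + 1))
  let v : ℕ → ℕ → Fin (n + 1) → ℂ := fun i j a => x ⟨i, j, a⟩
  refine ⟨fun i => Submodule.span ℂ (Set.range fun j : Fin (m i + 1) => v i j), ?_, ?_⟩
  · intro i hi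
    rw [Finset.mem_Icc] at hi
    have hmi : m i + 1 ≤ n + 1 := by
      have := hmono 1 i le_rfl hi.1 hi.2
      omega
    have h1 := generic_indep hmi x hx (fun y => ⟨i, (y.1 : ℕ), y.2⟩) (by
      rintro ⟨a, b⟩ ⟨c, d⟩ h
      simp at h
      ext <;> simp [h])
    have h2 : LinearIndependent ℂ (fun j : Fin (m i + 1) => v i j) := h1
    rw [finrank_span_eq_card h2]
    simp
  · rintro ⟨q, hq, hW⟩
    obtain ⟨S, hS, hrank, hdot⟩ := form_matrix n q
    rw [hq] at hrank
    have hrN : r ≤ n + 1 := by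
      rw [← hrank]; simpa using S.rank_le_width
    obtain ⟨c, T, hc, hT, hcard⟩ := symm_count S hS (by omega)
    have hS' : (c • S).IsSymm := hS.smul c
    have hrank' : (c • S).rank = 2 * p := by
      rw [Matrix.rank_smul_of_mem_nonZeroDivisors S (mem_nonZeroDivisors_of_ne_zero hc), hrank, hr]
    have hiso : ∀ i ∈ Finset.Icc 1 s, ∀ j < m i + 1, ∀ l < m i + 1,
        dotProduct (v i j) (Matrix.mulVec (c • S) (v i l)) = 0 := by
      intro i hi j hj l hl
      have hj' : v i j ∈ Submodule.span ℂ (Set.range fun j : Fin (m i + 1) => v i j) :=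
        Submodule.subset_span ⟨⟨j, hj⟩, rfl⟩
      have hl' : v i l ∈ Submodule.span ℂ (Set.range fun j : Fin (m i + 1) => v i j) :=
        Submodule.subset_span ⟨⟨l, hl⟩, rfl⟩
      rw [Matrix.smul_mulVec, dotProduct_smul, hdot, QuadraticMap.polar,
        hW i hi _ hj', hW i hi _ hl', hW i hi _ (add_mem hj' hl')]
      simp
    have hex : ∀ i, ∃ T' : Finset ℂ, i ∈ Finset.Icc 1 s →
        (∀ j < m i + 1, ∀ a, v i j a ∈ acl (T ∪ T')) ∧
        2 * T'.card + codim2 p (m i) ≤ 2 * ((n + 1) * (m i + 1)) := by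
      intro i
      by_cases hi : i ∈ Finset.Icc 1 s
      · obtain ⟨T', h1, h2⟩ := iso_final (T : Set ℂ) (c • S) hS' hrank' hT (v i) (m i) (hiso i hi)
        exact ⟨T', fun _ => ⟨h1, h2⟩⟩
      · exact ⟨∅, fun h => absurd h hi⟩
    choose U hU using hex
    let J : Finset (Σ _ : ℕ, ℕ × Fin (n + 1)) :=
      (Finset.Icc 1 s).sigma fun i => Finset.range (m i + 1) ×ˢ Finset.univ
    have hcount := acl_count hx J (T ∪ (Finset.Icc 1 s).biUnion U) (by
      rintro ⟨i, j, a⟩ hj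
      simp only [J, Finset.mem_sigma, Finset.mem_product, Finset.mem_range] at hj
      refine acl_mono ?_ ((hU i hj.1).1 j hj.2.1 a)
      intro y hy
      rw [Finset.mem_coe, Finset.mem_union, Finset.mem_biUnion]
      rcases hy with hy | hy
      · exact Or.inl hy
      · exact Or.inr ⟨i, hj.1, hy⟩)
    have hJ : J.card = ∑ i ∈ Finset.Icc 1 s, (n + 1) * (m i + 1) := by
      simp only [J, Finset.card_sigma, Finset.card_product, Finset.card_range, Finset.card_univ,
        Fintype.card_fin]
      exact Finset.sum_congr rfl fun i _ => mul_comm _ _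
    have hT2 : (T ∪ (Finset.Icc 1 s).biUnion U).card ≤
        T.card + ∑ i ∈ Finset.Icc 1 s, (U i).card :=
      (Finset.card_union_le _ _).trans (add_le_add le_rfl Finset.card_biUnion_le)
    have hsum : ∑ i ∈ Finset.Icc 1 s, (2 * (U i).card + codim2 p (m i)) ≤
        ∑ i ∈ Finset.Icc 1 s, 2 * ((n + 1) * (m i + 1)) :=
      Finset.sum_le_sum fun i hi => (hU i hi).2
    rw [Finset.sum_add_distrib, ← Finset.mul_sum, ← Finset.mul_sum, ← hJ] at hsum
    have hcod : ∑ i ∈ Finset.Icc 1 s, codim2 p (m i) =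
        2 * ∑ i ∈ (Finset.Icc 1 s).filter (fun i => m i < p), (m i + 2).choose 2
        + p * ∑ i ∈ (Finset.Icc 1 s).filter (fun i => p ≤ m i), (2 * m i + 3 - p) := by
      unfold codim2
      rw [Finset.sum_ite, Finset.mul_sum, Finset.mul_sum]
      simp only [not_lt]
    rw [← hcod] at hineq
    have hD : 2 * ((n + 2).choose 2 - (n + 2 - r).choose 2) + r * (r - 1) = 2 * r * (n + 1) := by
      obtain ⟨k, hk⟩ := Nat.exists_eq_add_of_le hrN
      have e1 : n + 2 - r = k + 1 := by omega
      have h2 : ∀ a : ℕ, 2 * (a + 1).choose 2 = (a + 1) * a := by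
        intro a
        rw [Nat.choose_two_right, Nat.add_sub_cancel, Nat.mul_div_cancel']
        rw [mul_comm]; exact (Nat.even_mul_succ_self a).two_dvd
      have h3 := h2 (n + 1)
      have h4 := h2 k
      rw [e1, Nat.mul_sub]
      rw [show n + 2 = n + 1 + 1 from rfl, h3, h4, hk]
      have h5 : (k + 1) * k ≤ (r + k + 1) * (r + k) := by nlinarith
      zify [h5, hr1]
      ring
    rw [hrank] at hcard
    push_cast at hcard
    zify [hr1] at hD hineq hsum hT2 hcount
    linarith
end

section
/- Let n, s, p be integers with s ≥ 2, let m_1 ≥ m_2 ≥ … ≥ m_s ≥ 0 with m_1 + m_2 < n, and let r = 2p + 1 be an odd integer with 1 ≤ r ≤ 2n − 2m_1. Assume 2·[C(n+2,2) − C(n+2−r,2)] ≤ 2·Σ_{i : m_i ≤ p−1} C(m_i+2,2) + Σ_{i : m_i ≥ p} (2m_i + 2 + p(2m_i + 1 − p)). Then there exist subspaces W_1, …, W_s of ℂ^{n+1} with dim W_i = m_i + 1 such that no quadratic form of rank exactly r vanishes identically on every W_i, i.e. Q(W_1,…,W_s) contains no rank r quadric. -/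
open scoped IntermediateField.algebraAdjoinAdjoin TensorProduct in
lemma exists_derivation_of_trbasis {ι : Type*} {v : ι → ℂ} (hv : IsTranscendenceBasis ℚ v)
    (y : ι → ℂ) : ∃ D : Derivation ℚ ℂ ℂ, ∀ i, D (v i) = y i := by
  have e1 : Algebra.FormallyEtale (Algebra.adjoin ℚ (Set.range v))
      (IntermediateField.adjoin ℚ (Set.range v)) :=
    .of_isLocalization (nonZeroDivisors _)
  have : Algebra.IsAlgebraic (IntermediateField.adjoin ℚ (Set.range v)) ℂ := hv.isAlgebraic_field
  have e2 : Algebra.FormallyEtale (IntermediateField.adjoin ℚ (Set.range v)) ℂ :=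
    Algebra.FormallyEtale.of_isSeparable _ _
  have e3 : Algebra.FormallyEtale (Algebra.adjoin ℚ (Set.range v)) ℂ :=
    .comp _ (IntermediateField.adjoin ℚ (Set.range v)) _
  let _ : Algebra (MvPolynomial ι ℚ) ℂ := (MvPolynomial.aeval v).toRingHom.toAlgebra
  have hsm : ∀ (p : MvPolynomial ι ℚ) (z : ℂ), p • z = MvPolynomial.aeval v p * z := fun _ _ => rfl
  have _ : IsScalarTower ℚ (MvPolynomial ι ℚ) ℂ := IsScalarTower.of_algebraMap_eq (fun q => by
    change _ = MvPolynomial.aeval v _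
    simp)
  let d0 : Derivation ℚ (MvPolynomial ι ℚ) ℂ := MvPolynomial.mkDerivation ℚ y
  have hS : ∀ (a : Algebra.adjoin ℚ (Set.range v)),
      MvPolynomial.aeval v (hv.1.aevalEquiv.symm a) = (a : ℂ) := by
    intro a
    have := hv.1.algebraMap_aevalEquiv (hv.1.aevalEquiv.symm a)
    rw [← this]; simp
  let d1 : Derivation ℚ (Algebra.adjoin ℚ (Set.range v)) ℂ := Derivation.mk'
    ((d0 : MvPolynomial ι ℚ →ₗ[ℚ] ℂ) ∘ₗ hv.1.aevalEquiv.symm.toLinearMap) (by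
      intro a b
      simp only [LinearMap.comp_apply, AlgEquiv.toLinearMap_apply, map_mul]
      have := d0.leibniz (hv.1.aevalEquiv.symm a) (hv.1.aevalEquiv.symm b)
      rw [hsm, hsm, hS, hS] at this
      exact this)
  let L := d1.liftKaehlerDifferential
  let L' : ℂ ⊗[Algebra.adjoin ℚ (Set.range v)] Ω[Algebra.adjoin ℚ (Set.range v)⁄ℚ] →ₗ[ℂ] ℂ :=
    LinearMap.liftBaseChange ℂ L
  let e := KaehlerDifferential.tensorKaehlerEquivOfFormallyEtale ℚ (Algebra.adjoin ℚ (Set.range v)) ℂ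
  refine ⟨(L' ∘ₗ e.symm.toLinearMap).compDer (KaehlerDifferential.D ℚ ℂ), fun i => ?_⟩
  have hi := KaehlerDifferential.tensorKaehlerEquivOfFormallyEtale_symm_D_algebraMap ℚ
    (Algebra.adjoin ℚ (Set.range v)) ℂ (hv.1.aevalEquiv (MvPolynomial.X i))
  have hvi : algebraMap (Algebra.adjoin ℚ (Set.range v)) ℂ (hv.1.aevalEquiv (MvPolynomial.X i)) = v i := by
    rw [hv.1.algebraMap_aevalEquiv]; simp
  rw [hvi] at hi
  change L' (e.symm (KaehlerDifferential.D ℚ ℂ (v i))) = _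
  rw [show e.symm (KaehlerDifferential.D ℚ ℂ (v i)) = _ from hi]
  simp only [L', LinearMap.liftBaseChange_tmul, one_smul, L, Derivation.liftKaehlerDifferential_comp_D]
  change d0 (hv.1.aevalEquiv.symm (hv.1.aevalEquiv (MvPolynomial.X i))) = _
  simp [d0]

lemma exists_generic_s2 (κ : Type) [Countable κ] : ∃ x : κ → ℂ, ∀ y : κ → ℂ,
    ∃ D : Derivation ℚ ℂ ℂ, ∀ i, D (x i) = y i := by
  obtain ⟨s, hs⟩ := exists_isTranscendenceBasis ℚ ℂ
  have hc := IsAlgClosed.cardinal_eq_cardinal_transcendence_basis_of_aleph0_lt' _ hs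
    (by simp) (by simpa using Cardinal.aleph0_lt_continuum)
  have : Infinite s := by
    rw [Cardinal.infinite_iff, ← hc]; simpa using Cardinal.aleph0_le_continuum
  obtain ⟨g, hg⟩ := exists_injective_nat κ
  let f : κ ↪ s := (⟨g, hg⟩ : κ ↪ ℕ).trans (Infinite.natEmbedding s)
  refine ⟨fun t => (f t : ℂ), fun y => ?_⟩
  obtain ⟨D, hD⟩ := exists_derivation_of_trbasis hs (Function.extend f y 0)
  refine ⟨D, fun i => ?_⟩
  rw [hD (f i), f.injective.extend_apply]

open Module

lemma exists_eval_eq {V : Type*} [AddCommGroup V] [Module ℂ V] [FiniteDimensional ℂ V]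
    {κ : Type*} {f : κ → Dual ℂ V} (hf : LinearIndependent ℂ f) (t : κ → ℂ) :
    ∃ v : V, ∀ b, f b v = t b := by
  obtain ⟨g, hg⟩ := LinearMap.exists_extend ((Finsupp.linearCombination ℂ t) ∘ₗ (hf.repr : _ →ₗ[ℂ] _))
  refine ⟨(evalEquiv ℂ V).symm g, fun b => ?_⟩
  rw [apply_evalEquiv_symm_apply]
  have := LinearMap.congr_fun hg ⟨f b, Submodule.subset_span ⟨b, rfl⟩⟩
  simp only [LinearMap.comp_apply, Submodule.subtype_apply] at this
  rw [this]
  simp [hf.repr_eq_single b ⟨f b, Submodule.subset_span ⟨b, rfl⟩⟩ rfl]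

lemma local_struct {V U : Type*} [AddCommGroup V] [Module ℂ V] [FiniteDimensional ℂ V]
    [AddCommGroup U] [Module ℂ U] [FiniteDimensional ℂ U]
    (B : V →ₗ[ℂ] V →ₗ[ℂ] ℂ) (hB : ∀ x y, B x y = B y x) (E : U →ₗ[ℂ] V)
    (hE : ∀ u u', B (E u) (E u') = 0) (r M : ℕ) (hM : finrank ℂ U = M)
    (hr : r + finrank ℂ (LinearMap.ker B) = finrank ℂ V) :
    ∃ k, k ≤ M ∧ 2 * k ≤ r ∧ ∃ (s : Fin (M - k) → U) (c : Fin k → U) (w : Fin (r - k) → V),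
      (∀ a, B (E (s a)) = 0) ∧ (∀ b u, B (E u) (w b) = 0) ∧
      ∀ (z1 : Fin (M - k) → Fin (r - k) → ℂ) (z2 : Fin k → Fin k → ℂ),
        (∀ a b, z2 a b = z2 b a) → ∃ Y : U →ₗ[ℂ] V,
          (∀ a b, B (Y (s a)) (w b) = z1 a b) ∧
          ∀ a b, B (Y (c a)) (E (c b)) + B (E (c a)) (Y (c b)) = z2 a b := by
  let G : U →ₗ[ℂ] Dual ℂ V := B ∘ₗ E
  obtain ⟨C, hC⟩ := Submodule.exists_isCompl (LinearMap.ker G)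
  have h1 := LinearMap.finrank_range_add_finrank_ker G
  have h2 := Submodule.finrank_add_eq_of_isCompl hC
  set k := finrank ℂ (LinearMap.range G) with hk
  let P : Submodule ℂ V := (LinearMap.range G).dualCoannihilator
  have hP : ∀ w, w ∈ P ↔ ∀ u, B (E u) w = 0 := by
    intro w
    rw [Submodule.mem_dualCoannihilator]
    exact ⟨fun h u => h _ ⟨u, rfl⟩, by rintro h _ ⟨u, rfl⟩; exact h u⟩
  have h3 : k + finrank ℂ P = finrank ℂ V := Subspace.finrank_add_finrank_dualCoannihilator_eq _
  have hRP : LinearMap.ker B ≤ P := by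
    intro w hw
    rw [hP]; intro u; rw [hB, LinearMap.mem_ker.1 hw]; rfl
  have h4 := LinearMap.finrank_range_add_finrank_ker (B.domRestrict P)
  have h5 : finrank ℂ (LinearMap.ker (B.domRestrict P)) = finrank ℂ (LinearMap.ker B) := by
    rw [LinearMap.ker_domRestrict]
    exact (Submodule.comapSubtypeEquivOfLe hRP).finrank_eq
  have h6 : k ≤ finrank ℂ (LinearMap.range (B.domRestrict P)) := by
    apply Submodule.finrank_mono
    rintro _ ⟨u, rfl⟩
    exact ⟨⟨E u, (hP _).2 fun u' => hE u' u⟩, rfl⟩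
  let bS : Basis (Fin (M - k)) ℂ (LinearMap.ker G) := finBasisOfFinrankEq ℂ _ (by omega)
  let bC : Basis (Fin k) ℂ C := finBasisOfFinrankEq ℂ _ (by omega)
  let bW : Basis (Fin (r - k)) ℂ (LinearMap.range (B.domRestrict P)) :=
    finBasisOfFinrankEq ℂ _ (by omega)
  have hw : ∀ b, ∃ w : P, B w = bW b := fun b => (bW b).2
  choose w hw using hw
  have iW : LinearIndependent ℂ (fun b => B (w b : V)) := by
    simp_rw [hw]
    exact bW.linearIndependent.map' (Submodule.subtype _) (Submodule.ker_subtype _)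
  have iC : LinearIndependent ℂ (fun b => B (E (bC b : U))) := by
    have h := bC.linearIndependent.map' (G.domRestrict C) (by
      rw [LinearMap.ker_domRestrict]
      exact Submodule.disjoint_iff_comap_eq_bot.1 hC.symm.disjoint)
    exact h
  refine ⟨k, by omega, by omega, fun a => bS a, fun a => bC a, fun b => w b, ?_, ?_, ?_⟩
  · intro a; exact (bS a).2
  · intro b; exact (hP _).1 (w b).2
  · intro z1 z2 hz
    choose v hv using fun a => exists_eval_eq iW (z1 a)
    choose y hy using fun a => exists_eval_eq iC (fun b => z2 a b / 2)
    refine ⟨LinearMap.ofIsCompl hC (bS.constr ℂ v) (bC.constr ℂ y), ?_, ?_⟩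
    · intro a b
      simp only [LinearMap.ofIsCompl_apply_left, Basis.constr_basis]
      rw [hB, hv]
    · intro a b
      simp only [LinearMap.ofIsCompl_apply_right, Basis.constr_basis]
      rw [hB, hy, hy, hz b a]; ring

/-- tangent directions to the rank locus -/
def tanSpace {V : Type*} [AddCommGroup V] [Module ℂ V] (B : V →ₗ[ℂ] V →ₗ[ℂ] ℂ) :
    Submodule ℂ (V →ₗ[ℂ] V →ₗ[ℂ] ℂ) where
  carrier := {X | (∀ v w, X v w = X w v) ∧
    ∀ v ∈ LinearMap.ker B, ∀ w ∈ LinearMap.ker B, X v w = 0}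
  zero_mem' := by simp
  add_mem' := by
    rintro X Y ⟨h1, h2⟩ ⟨h3, h4⟩
    refine ⟨fun v w => ?_, fun v hv w hw => ?_⟩
    · simp [h1 v w, h3 v w]
    · simp [h2 v hv w hw, h4 v hv w hw]
  smul_mem' := by
    rintro c X ⟨h1, h2⟩
    refine ⟨fun v w => ?_, fun v hv w hw => ?_⟩
    · simp [h1 v w]
    · simp [h2 v hv w hw]

/-- evaluation of a bilinear form in the tangent space at a pair -/
noncomputable def tanEval {V : Type*} [AddCommGroup V] [Module ℂ V] (B : V →ₗ[ℂ] V →ₗ[ℂ] ℂ) (v w : V) :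
    tanSpace B →ₗ[ℂ] ℂ :=
  (LinearMap.applyₗ w ∘ₗ LinearMap.applyₗ v) ∘ₗ (tanSpace B).subtype

lemma tanEval_apply {V : Type*} [AddCommGroup V] [Module ℂ V] (B : V →ₗ[ℂ] V →ₗ[ℂ] ℂ) (v w : V)
    (X : tanSpace B) : tanEval B v w X = X.1 v w := rfl

/-- evaluation at unordered pairs -/
noncomputable def tanSym {V κ : Type*} [AddCommGroup V] [Module ℂ V] (B : V →ₗ[ℂ] V →ₗ[ℂ] ℂ)
    (e : κ → V) : Sym2 κ → (tanSpace B →ₗ[ℂ] ℂ) :=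
  Sym2.lift ⟨fun a b => tanEval B (e a) (e b), fun _ _ => LinearMap.ext fun X => X.2.1 _ _⟩

lemma tanSym_apply {V κ : Type*} [AddCommGroup V] [Module ℂ V] (B : V →ₗ[ℂ] V →ₗ[ℂ] ℂ)
    (e : κ → V) (a b : κ) (X : tanSpace B) : tanSym B e s(a, b) X = X.1 (e a) (e b) := rfl

lemma finrank_tanSpace_le {V : Type*} [AddCommGroup V] [Module ℂ V] [FiniteDimensional ℂ V]
    (B : V →ₗ[ℂ] V →ₗ[ℂ] ℂ) (r t : ℕ) (ht : finrank ℂ (LinearMap.ker B) = t)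
    (hr : r + t = finrank ℂ V) :
    finrank ℂ (tanSpace B) ≤ r * t + (r + 1).choose 2 := by
  obtain ⟨C, hC⟩ := Submodule.exists_isCompl (LinearMap.ker B)
  have h2 := Submodule.finrank_add_eq_of_isCompl hC
  let bR : Basis (Fin t) ℂ (LinearMap.ker B) := finBasisOfFinrankEq ℂ _ ht
  let bC : Basis (Fin r) ℂ C := finBasisOfFinrankEq ℂ _ (by omega)
  let b : Basis (Fin t ⊕ Fin r) ℂ V := (bR.prod bC).map (Submodule.prodEquivOfIsCompl _ _ hC)
  have b1 : ∀ a, b (Sum.inl a) = bR a := by intro a; simp [b]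
  have b2 : ∀ a, b (Sum.inr a) = bC a := by intro a; simp [b]
  let Φ : tanSpace B →ₗ[ℂ] ((Fin r × Fin t) ⊕ Sym2 (Fin r) → ℂ) :=
    LinearMap.pi (Sum.elim (fun p => tanEval B (bC p.1) (bR p.2)) (tanSym B (fun a => (bC a : V))))
  have hΦ : Function.Injective Φ := by
    rw [injective_iff_map_eq_zero]
    intro X hX
    have e1 : ∀ a c, X.1 (bC a) (bR c) = 0 := fun a c => congrFun hX (Sum.inl (a, c))
    have e2 : ∀ a c, X.1 (bC a) (bC c) = 0 := fun a c => congrFun hX (Sum.inr s(a, c))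
    apply Subtype.ext
    refine LinearMap.ext_basis b b ?_
    rintro (a | a) (c | c)
    · rw [b1, b1]; exact X.2.2 _ (bR a).2 _ (bR c).2
    · rw [b1, b2, X.2.1]; exact e1 _ _
    · rw [b1, b2]; exact e1 _ _
    · rw [b2, b2]; exact e2 _ _
  have := LinearMap.finrank_le_finrank_of_injective hΦ
  simpa [Sym2.card] using this

lemma finrank_succ_le_aux {A Z : Type*} [AddCommGroup A] [Module ℂ A] [AddCommGroup Z] [Module ℂ Z]
    [Module.Finite ℂ A] (Φ : A →ₗ[ℂ] Z) (hΦ : Function.Surjective Φ) (x : A) (hx : x ≠ 0)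
    (hx' : Φ x = 0) : finrank ℂ Z + 1 ≤ finrank ℂ A := by
  have hpos : 0 < finrank ℂ (LinearMap.ker Φ) := by
    rw [finrank_pos_iff_exists_ne_zero]
    exact ⟨⟨x, hx'⟩, fun h => hx (congrArg Subtype.val h)⟩
  have h1 := LinearMap.finrank_range_add_finrank_ker Φ
  rw [LinearMap.range_eq_top.2 hΦ, finrank_top] at h1
  omega

lemma finrank_succ_le {A Z : Type*} [AddCommMonoid A] [Module ℂ A] [AddCommGroup Z] [Module ℂ Z]
    [Module.Finite ℂ A] (Φ : A →ₗ[ℂ] Z) (hΦ : Function.Surjective Φ) (x : A) (hx : x ≠ 0)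
    (hx' : Φ x = 0) : finrank ℂ Z + 1 ≤ finrank ℂ A :=
  let _ : AddCommGroup A := Module.addCommMonoidToAddCommGroup ℂ
  finrank_succ_le_aux Φ hΦ x hx hx'

lemma global_count {V κ : Type*} [AddCommGroup V] [Module ℂ V] [FiniteDimensional ℂ V] [Fintype κ]
    (B : V →ₗ[ℂ] V →ₗ[ℂ] ℂ) (hB : ∀ x y, B x y = B y x) (hB0 : B ≠ 0)
    (r t : ℕ) (ht : finrank ℂ (LinearMap.ker B) = t) (hr : r + t = finrank ℂ V)
    (M : κ → ℕ) (E : ∀ i, (Fin (M i) → ℂ) →ₗ[ℂ] V)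
    (hE : ∀ i u u', B (E i u) (E i u') = 0)
    (hX : ∀ Y : ∀ i, (Fin (M i) → ℂ) →ₗ[ℂ] V, ∃ X ∈ tanSpace B,
      (∀ i u u', X (E i u) (E i u') + B (Y i u) (E i u') + B (E i u) (Y i u') = 0) ∧
      (∀ i u w, B (E i u) = 0 → (∀ u', B (E i u') w = 0) → X (E i u) w + B (Y i u) w = 0)) :
    ∃ k : κ → ℕ, (∀ i, k i ≤ M i ∧ 2 * k i ≤ r) ∧
      ∑ i, ((M i - k i) * (r - k i) + (k i + 1).choose 2) + 1 ≤ r * t + (r + 1).choose 2 := by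
  choose k hk1 hk2 s c w hs hw hY using fun i =>
    local_struct B hB (E i) (hE i) r (M i) (by simp) (by omega)
  refine ⟨k, fun i => ⟨hk1 i, hk2 i⟩, ?_⟩
  let J := Σ i, (Fin (M i - k i) × Fin (r - k i)) ⊕ Sym2 (Fin (k i))
  let f : J → (tanSpace B →ₗ[ℂ] ℂ) := fun j =>
    Sum.elim (fun p => tanEval B (E j.1 (s j.1 p.1)) (w j.1 p.2))
      (tanSym B (fun a => E j.1 (c j.1 a))) j.2
  let Φ : tanSpace B →ₗ[ℂ] (J → ℂ) := LinearMap.pi f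
  have hΦ : Function.Surjective Φ := by
    intro z
    choose Y hY1 hY2 using fun i => hY i (fun a b => - z ⟨i, Sum.inl (a, b)⟩)
      (fun a b => - z ⟨i, Sum.inr s(a, b)⟩) (fun a b => by rw [Sym2.eq_swap])
    obtain ⟨X, hXm, hX1, hX2⟩ := hX Y
    refine ⟨⟨X, hXm⟩, ?_⟩
    funext ⟨i, j⟩
    rcases j with ⟨a, b⟩ | p
    · change X (E i (s i a)) (w i b) = _
      have := hX2 i (s i a) (w i b) (hs i a) (hw i b)
      rw [hY1] at this
      linear_combination this
    · induction p using Sym2.ind with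
      | _ a b =>
      change X (E i (c i a)) (E i (c i b)) = _
      have h1 := hX1 i (c i a) (c i b)
      have h2 := hY2 i a b
      linear_combination h1 - h2
  have hBm : B ∈ tanSpace B := ⟨hB, fun v hv w _ => by rw [LinearMap.mem_ker.1 hv]; rfl⟩
  have hker : (⟨B, hBm⟩ : tanSpace B) ∈ LinearMap.ker Φ := by
    rw [LinearMap.mem_ker]
    funext ⟨i, j⟩
    rcases j with ⟨a, b⟩ | p
    · exact hw i b _
    · induction p using Sym2.ind with
      | _ a b => exact hE i _ _
  have h1 := finrank_succ_le Φ hΦ ⟨B, hBm⟩ (fun h => hB0 (congrArg Subtype.val h)) hker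
  have h2 := finrank_tanSpace_le B r t ht hr
  have h3 : finrank ℂ (J → ℂ) = ∑ i, ((M i - k i) * (r - k i) + (k i + 1).choose 2) := by
    simp [J, Sym2.card]
  omega

/-- derivative of a bilinear form along a derivation of the scalars -/
noncomputable def dB {N : ℕ} (D : Derivation ℚ ℂ ℂ)
    (B : (Fin N → ℂ) →ₗ[ℂ] (Fin N → ℂ) →ₗ[ℂ] ℂ) :
    (Fin N → ℂ) →ₗ[ℂ] (Fin N → ℂ) →ₗ[ℂ] ℂ :=
  Matrix.toLinearMap₂' ℂ (Matrix.of fun a b => D (B (Pi.single a 1) (Pi.single b 1)))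

lemma bilin_expand {N : ℕ} (B : (Fin N → ℂ) →ₗ[ℂ] (Fin N → ℂ) →ₗ[ℂ] ℂ) (v w : Fin N → ℂ) :
    B v w = ∑ a, ∑ b, v a * w b * B (Pi.single a 1) (Pi.single b 1) := by
  conv_lhs => rw [pi_eq_sum_univ' v, pi_eq_sum_univ' w]
  simp only [map_sum, LinearMap.sum_apply, map_smul, LinearMap.smul_apply, smul_eq_mul]
  rw [Finset.sum_comm]
  refine Finset.sum_congr rfl fun a _ => ?_
  rw [Finset.mul_sum]
  refine Finset.sum_congr rfl fun b _ => ?_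
  ring

lemma dB_apply {N : ℕ} (D : Derivation ℚ ℂ ℂ)
    (B : (Fin N → ℂ) →ₗ[ℂ] (Fin N → ℂ) →ₗ[ℂ] ℂ) (v w : Fin N → ℂ) :
    dB D B v w = ∑ a, ∑ b, v a * w b * D (B (Pi.single a 1) (Pi.single b 1)) := by
  simp only [dB, Matrix.toLinearMap₂'_apply, Matrix.of_apply, smul_eq_mul, mul_assoc]

lemma dB_leibniz {N : ℕ} (D : Derivation ℚ ℂ ℂ)
    (B : (Fin N → ℂ) →ₗ[ℂ] (Fin N → ℂ) →ₗ[ℂ] ℂ) (v w : Fin N → ℂ) :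
    D (B v w) = dB D B v w + B (fun a => D (v a)) w + B v (fun a => D (w a)) := by
  rw [dB_apply, bilin_expand B v w, bilin_expand B _ w, bilin_expand B v (fun a => D (w a))]
  simp only [map_sum, Derivation.leibniz, smul_eq_mul, ← Finset.sum_add_distrib]
  refine Finset.sum_congr rfl fun a _ => Finset.sum_congr rfl fun b _ => ?_
  ring

/-- the linear map with given columns -/
noncomputable def colMap {M N : ℕ} (x : Fin M → Fin N → ℂ) : (Fin M → ℂ) →ₗ[ℂ] (Fin N → ℂ) :=
  Fintype.linearCombination ℂ x

lemma colMap_apply {M N : ℕ} (x : Fin M → Fin N → ℂ) (u : Fin M → ℂ) (j : Fin N) :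
    colMap x u j = ∑ a, u a * x a j := by
  simp [colMap, Fintype.linearCombination_apply]

lemma colMap_single {M N : ℕ} (Y : (Fin M → ℂ) →ₗ[ℂ] (Fin N → ℂ)) :
    colMap (fun a => Y (Pi.single a 1)) = Y := by
  refine LinearMap.pi_ext' fun a => LinearMap.ext_ring ?_
  simp [colMap]

lemma D_colMap {M N : ℕ} (D : Derivation ℚ ℂ ℂ) (x y : Fin M → Fin N → ℂ)
    (h : ∀ a j, D (x a j) = y a j) (u : Fin M → ℂ) :
    (fun j => D (colMap x u j)) = colMap y u + colMap x (fun a => D (u a)) := by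
  funext j
  simp only [Pi.add_apply, colMap_apply, map_sum, Derivation.leibniz, smul_eq_mul, h,
    ← Finset.sum_add_distrib]
  refine Finset.sum_congr rfl fun a _ => ?_
  ring

lemma colMap_injective {M N : ℕ} (hMN : M ≤ N) (x : Fin M → Fin N → ℂ)
    (hx : ∀ y : Fin M → Fin N → ℂ, ∃ D : Derivation ℚ ℂ ℂ, ∀ a j, D (x a j) = y a j) :
    Function.Injective (colMap x) := by
  rw [injective_iff_map_eq_zero]
  intro u hu
  by_contra hu0
  obtain ⟨a, ha⟩ := Function.ne_iff.1 hu0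
  have h1 := LinearMap.finrank_range_add_finrank_ker (colMap x)
  have hpos : 0 < finrank ℂ (LinearMap.ker (colMap x)) := by
    rw [finrank_pos_iff_exists_ne_zero]
    exact ⟨⟨u, hu⟩, fun h => hu0 (congrArg Subtype.val h)⟩
  simp only [finrank_fintype_fun_eq_card, Fintype.card_fin] at h1
  have hne : LinearMap.range (colMap x) ≠ ⊤ := by
    intro h
    rw [h, finrank_top] at h1
    simp only [finrank_fintype_fun_eq_card, Fintype.card_fin] at h1
    omega
  obtain ⟨v, hv⟩ : ∃ v, v ∉ LinearMap.range (colMap x) := by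
    by_contra! h
    exact hne (eq_top_iff.2 fun v _ => h v)
  obtain ⟨D, hD⟩ := hx (fun b => if b = a then (u a)⁻¹ • v else 0)
  have h2 := D_colMap D x _ hD u
  have h3 : colMap (fun b => if b = a then (u a)⁻¹ • v else 0) u = v := by
    funext j
    rw [colMap_apply, Finset.sum_eq_single a]
    · simp only [if_true, Pi.smul_apply, smul_eq_mul]
      exact mul_inv_cancel_left₀ ha _
    · intro b _ hb; simp [hb]
    · simp
  rw [h3, hu] at h2
  apply hv
  refine ⟨- (fun a => D (u a)), ?_⟩
  rw [map_neg, eq_comm, ← sub_eq_zero, sub_neg_eq_add, ← h2]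
  funext j; simp

lemma generic_count {κ : Type*} [Fintype κ] {N : ℕ}
    (B : (Fin N → ℂ) →ₗ[ℂ] (Fin N → ℂ) →ₗ[ℂ] ℂ) (hB : ∀ x y, B x y = B y x) (hB0 : B ≠ 0)
    (r t : ℕ) (ht : finrank ℂ (LinearMap.ker B) = t) (hr : r + t = N)
    (M : κ → ℕ) (x : ∀ i, Fin (M i) → Fin N → ℂ)
    (hx : ∀ y : ∀ i, Fin (M i) → Fin N → ℂ, ∃ D : Derivation ℚ ℂ ℂ,
      ∀ i a j, D (x i a j) = y i a j)
    (hE : ∀ i u u', B (colMap (x i) u) (colMap (x i) u') = 0) :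
    ∃ k : κ → ℕ, (∀ i, k i ≤ M i ∧ 2 * k i ≤ r) ∧
      ∑ i, ((M i - k i) * (r - k i) + (k i + 1).choose 2) + 1 ≤ r * t + (r + 1).choose 2 := by
  refine global_count B hB hB0 r t ht (by simpa using hr) M (fun i => colMap (x i)) hE ?_
  intro Y
  obtain ⟨D, hD⟩ := hx (fun i a => Y i (Pi.single a 1))
  have hDE : ∀ i u, (fun j => D (colMap (x i) u j)) = Y i u + colMap (x i) (fun a => D (u a)) := by
    intro i u
    rw [D_colMap D (x i) _ (hD i) u, colMap_single]
  refine ⟨dB D B, ⟨fun v w => ?_, fun v hv w hw => ?_⟩, fun i u u' => ?_, fun i u w hu hw => ?_⟩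
  · rw [dB_apply, dB_apply, Finset.sum_comm]
    refine Finset.sum_congr rfl fun a _ => Finset.sum_congr rfl fun b _ => ?_
    rw [hB (Pi.single a 1)]; ring
  · have h := dB_leibniz D B v w
    rw [hB (fun a => D (v a)) w, LinearMap.mem_ker.1 hv, LinearMap.mem_ker.1 hw] at h
    simpa using h.symm
  · have h := dB_leibniz D B (colMap (x i) u) (colMap (x i) u')
    rw [hDE, hDE, hE] at h
    simp only [map_add, LinearMap.add_apply, hE, map_zero, add_zero] at h
    exact h.symm
  · have h := dB_leibniz D B (colMap (x i) u) w
    rw [hDE, hu] at h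
    simp only [map_add, LinearMap.add_apply, hw, map_zero, add_zero, LinearMap.zero_apply] at h
    exact h.symm

lemma two_mul_choose_two (k : ℕ) : 2 * (k + 1).choose 2 = k * (k + 1) := by
  rw [Nat.choose_two_right, Nat.mul_div_cancel' (Nat.even_mul_pred_self (k+1)).two_dvd,
    Nat.add_sub_cancel]
  ring

lemma codim_small (M k p : ℕ) (hk : k ≤ M) (hM : M ≤ p) :
    2 * (M + 1).choose 2 ≤ 2 * ((M - k) * (2 * p + 1 - k) + (k + 1).choose 2) := by
  rw [mul_add, two_mul_choose_two, two_mul_choose_two]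
  obtain ⟨j, rfl⟩ := Nat.exists_eq_add_of_le hk
  obtain ⟨t, rfl⟩ := Nat.exists_eq_add_of_le hM
  have h1 : k + j - k = j := by omega
  have h2 : 2 * (k + j + t) + 1 - k = k + 2 * j + 2 * t + 1 := by omega
  rw [h1, h2]
  nlinarith [Nat.zero_le (j * t), Nat.zero_le (j * j)]

lemma codim_large (m k p : ℕ) (hk : k ≤ p) (hM : p ≤ m) :
    2 * m + 2 + p * (2 * m + 1 - p) ≤
      2 * ((m + 1 - k) * (2 * p + 1 - k) + (k + 1).choose 2) := by
  rw [mul_add, two_mul_choose_two]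
  obtain ⟨j, rfl⟩ := Nat.exists_eq_add_of_le hk
  obtain ⟨t, rfl⟩ := Nat.exists_eq_add_of_le hM
  have h1 : k + j + t + 1 - k = j + t + 1 := by omega
  have h2 : 2 * (k + j) + 1 - k = k + 2 * j + 1 := by omega
  have h3 : 2 * (k + j + t) + 1 - (k + j) = k + j + 2 * t + 1 := by omega
  rw [h1, h2, h3]
  nlinarith [Nat.zero_le (j * t), Nat.zero_le (j * j)]

lemma rank_locus_dim (n r t : ℕ) (h : r + t = n + 1) :
    (n + 2).choose 2 - (n + 2 - r).choose 2 = r * t + (r + 1).choose 2 := by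
  have e1 := two_mul_choose_two (n + 1)
  have e2 := two_mul_choose_two t
  have e3 := two_mul_choose_two r
  have e4 : n + 2 - r = t + 1 := by omega
  rw [e4]
  rw [← h] at e1
  have e5 : n + 2 = r + t + 1 := by omega
  rw [e5]
  have : 2 * (r + t + 1).choose 2 = 2 * (t + 1).choose 2 + 2 * (r * t + (r + 1).choose 2) := by
    rw [mul_add, e1, e2, e3]; ring
  omega

/-- Rank-exclusion lemma, odd rank case: under the stated numerical inequality, a generic
configuration of linear spaces of weight vector `(m_1, …, m_s)` lies on no quadric of
rank `r = 2p + 1`. (`m` is 1-indexed: the components are `m 1, …, m s`.) -/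
theorem stmt2 (n s p r : ℕ) (m : ℕ → ℕ) (hs : 2 ≤ s)
    (hmono : ∀ i j, 1 ≤ i → i ≤ j → j ≤ s → m j ≤ m i)
    (h12 : m 1 + m 2 < n)
    (hr : r = 2 * p + 1) (hr1 : 1 ≤ r) (hr2 : r ≤ 2 * n - 2 * m 1)
    (hineq : 2 * ((n + 2).choose 2 - (n + 2 - r).choose 2) ≤
      2 * ∑ i ∈ (Finset.Icc 1 s).filter (fun i => m i < p), (m i + 2).choose 2
        + ∑ i ∈ (Finset.Icc 1 s).filter (fun i => p ≤ m i),
            (2 * m i + 2 + p * (2 * m i + 1 - p))) :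
    ∃ W : ℕ → Submodule ℂ (Fin (n + 1) → ℂ),
      (∀ i ∈ Finset.Icc 1 s, Module.finrank ℂ (W i) = m i + 1) ∧
      ¬ ∃ q : QuadraticForm ℂ (Fin (n + 1) → ℂ),
          quadRank n q = r ∧ ∀ i ∈ Finset.Icc 1 s, ∀ v ∈ W i, q v = 0 := by
  obtain ⟨x, hx⟩ := exists_generic_s2 (Σ i : ℕ, Fin (m i + 1) × Fin (n + 1))
  let X : ∀ i, Fin (m i + 1) → Fin (n + 1) → ℂ := fun i a j => x ⟨i, a, j⟩
  have hX : ∀ y : ∀ i, Fin (m i + 1) → Fin (n + 1) → ℂ, ∃ D : Derivation ℚ ℂ ℂ,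
      ∀ i a j, D (X i a j) = y i a j := by
    intro y
    obtain ⟨D, hD⟩ := hx (fun t => y t.1 t.2.1 t.2.2)
    exact ⟨D, fun i a j => hD ⟨i, a, j⟩⟩
  refine ⟨fun i => LinearMap.range (colMap (X i)), ?_, ?_⟩
  · intro i hi
    rw [Finset.mem_Icc] at hi
    have hle := hmono 1 i le_rfl hi.1 hi.2
    have hinj : Function.Injective (colMap (X i)) := by
      refine colMap_injective (by omega) _ fun y => ?_
      obtain ⟨D, hD⟩ := hX (Function.update (fun _ _ _ => 0) i y)
      refine ⟨D, fun a j => ?_⟩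
      rw [hD, Function.update_self]
    rw [LinearMap.finrank_range_of_inj hinj]
    simp
  · rintro ⟨q, hq, hv⟩
    let B : (Fin (n + 1) → ℂ) →ₗ[ℂ] (Fin (n + 1) → ℂ) →ₗ[ℂ] ℂ := QuadraticMap.polarBilin q
    have hBa : ∀ v w, B v w = QuadraticMap.polar q v w := fun v w => rfl
    have hrk : n + 1 - finrank ℂ (LinearMap.ker B) = r := hq
    have hB0 : B ≠ 0 := by
      intro h
      rw [h, LinearMap.ker_zero, finrank_top] at hrk
      simp at hrk
      omega
    obtain ⟨k, hk, hsum⟩ := generic_count (κ := Finset.Icc 1 s) B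
      (fun v w => by rw [hBa, hBa, QuadraticMap.polar_comm]) hB0 r
      (finrank ℂ (LinearMap.ker B)) rfl (by omega) (fun i => m i + 1) (fun i => X i)
      (fun y => by
        obtain ⟨D, hD⟩ := hX (fun i => if h : i ∈ Finset.Icc 1 s then y ⟨i, h⟩ else fun _ _ => 0)
        refine ⟨D, fun i a j => ?_⟩
        rw [hD, dif_pos i.2])
      (fun i u u' => by
        have h := hv i i.2
        rw [hBa, QuadraticMap.polar, ← map_add, h _ ⟨_, rfl⟩, h _ ⟨_, rfl⟩, h _ ⟨_, rfl⟩]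
        simp)
    rw [rank_locus_dim n r (finrank ℂ (LinearMap.ker B)) (by omega)] at hineq
    rw [Finset.mul_sum, Finset.sum_filter, Finset.sum_filter, ← Finset.sum_add_distrib,
      ← Finset.sum_coe_sort] at hineq
    have hle : ∑ i : Finset.Icc 1 s, ((if m i < p then 2 * (m i + 2).choose 2 else 0) +
        if p ≤ m i then 2 * m i + 2 + p * (2 * m i + 1 - p) else 0) ≤
        2 * ∑ i : Finset.Icc 1 s,
          ((m i + 1 - k i) * (r - k i) + (k i + 1).choose 2) := by
      rw [Finset.mul_sum]
      refine Finset.sum_le_sum fun i _ => ?_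
      have hki := hk i
      by_cases h : m i < p
      · rw [if_pos h, if_neg (by omega), add_zero, hr]
        exact codim_small (m i + 1) (k i) p hki.1 h
      · rw [if_neg h, if_pos (by omega), zero_add, hr]
        exact codim_large (m i) (k i) p (by omega) (by omega)
    omega
end

section
/- Let s ≥ 2 and m_1 ≥ m_2 ≥ … ≥ m_s ≥ 0 be integers with m_1 + m_2 < n, and assume Σ_{i=1}^s C(m_i+2,2) ≥ C(n+2,2). Then there exist subspaces W_1, …, W_s of ℂ^{n+1} with dim W_i = m_i + 1 and W_i ∩ W_j = {0} for i ≠ j such that Q(W_1,…,W_s) = {0}; that is, for a generic configuration of linear spaces Λ of weight vector (m_1,…,m_s) in P^n one has dim (I_Λ)_2 = 0. -/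
/-- deficit bound -/
lemma defA (a b r : ℤ) (hb : 0 ≤ b) (hba : b ≤ a) (hr : 2*b ≤ r) (hy : 2*a ≤ r) :
    4*(a*(a+1) - 2*(a-b)*(r-b) - b*(b+1)) ≤ 0 := by
  rcases eq_or_lt_of_le hba with h | h
  · subst h; nlinarith
  · have : a + 3*b+1-2*r ≤ 0 := by linarith
    nlinarith [mul_nonneg (sub_nonneg.2 hba) (neg_nonneg.2 this)]

lemma defB (a b r : ℤ) (hr : 2*b ≤ r) (hy : r ≤ 2*a) :
    4*(a*(a+1) - 2*(a-b)*(r-b) - b*(b+1)) ≤ (2*a-r)*(2*a-r+2) := by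
  rcases eq_or_lt_of_le hr with h | h
  · subst h; nlinarith
  · have h1 : 0 ≤ (r-2*b)*(2*(2*a-r)+3*(r-2*b)-2) := by
      apply mul_nonneg <;> linarith
    nlinarith

lemma defC (a b r : ℤ) (hr : 2*b ≤ r) (hy : 2*a - r = 1) :
    4*(a*(a+1) - 2*(a-b)*(r-b) - b*(b+1)) ≤ 0 := by
  obtain rfl : r = 2*a-1 := by linarith
  rcases eq_or_lt_of_le hr with h | h
  · omega
  · have h1 : b + 1 ≤ a := by omega
    nlinarith

lemma defD (a b r : ℤ) (hb : 0 ≤ b) (hba : b ≤ a) (hr : 2*b ≤ r) :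
    4*(a*(a+1) - 2*(a-b)*(r-b) - b*(b+1)) ≤ 4*(a*(a+1)) := by
  nlinarith [mul_nonneg (sub_nonneg.2 hba) (show 0 ≤ r - b by linarith)]

/-- ratio bound, relative to K -/
lemma ratioK (a b r K : ℤ) (hb : 0 ≤ b) (hba : b ≤ a) (hr : 2*b ≤ r) (haK : a ≤ K)
    (hK : r ≤ 2*K) (h0 : 0 ≤ r):
    4*(a*(a+1) - 2*(a-b)*(r-b) - b*(b+1)) * (K*(K+1)) ≤ a*(a+1)*((2*K-r)*(2*K-r+2)) := by
  have hK1 : 0 ≤ K*(K+1) := by nlinarith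
  have ha1 : 0 ≤ a*(a+1) := by nlinarith
  have hZ : 0 ≤ (2*K-r)*(2*K-r+2) := by nlinarith
  rcases le_total (2*a) r with h | h
  · have := defA a b r hb hba hr h
    nlinarith [mul_nonneg ha1 hZ, mul_nonneg (neg_nonneg.2 this) hK1]
  · have h1 := mul_le_mul_of_nonneg_right (defB a b r hr h) hK1
    refine h1.trans ?_
    have h2 : (2*a-r)*K ≤ a*(2*K-r) := by nlinarith
    have h3 : (2*a-r+2)*(K+1) ≤ (a+1)*(2*K-r+2) := by nlinarith
    have h4 : 0 ≤ (2*a-r+2)*(K+1) := by apply mul_nonneg <;> linarith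
    have h5 : 0 ≤ a*(2*K-r) := by apply mul_nonneg <;> linarith
    have := mul_le_mul h2 h3 h4 h5
    nlinarith

lemma ratioN (a b r N : ℤ) (hb : 0 ≤ b) (hba : b ≤ a) (hr : 2*b ≤ r) (haN : 2*a+1 ≤ N)
    (hN : r ≤ N) (h0 : 0 ≤ r):
    4*(a*(a+1) - 2*(a-b)*(r-b) - b*(b+1)) * (N*(N+1)) ≤ 4*(a*(a+1))*((N-r)*(N-r+1)) := by
  have hK1 : 0 ≤ N*(N+1) := by nlinarith
  have ha1 : 0 ≤ a*(a+1) := by nlinarith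
  have hZ : 0 ≤ (N-r)*(N-r+1) := by nlinarith
  rcases le_total (2*a) r with h | h
  · have := defA a b r hb hba hr h
    nlinarith [mul_nonneg ha1 hZ, mul_nonneg (neg_nonneg.2 this) hK1]
  · have h1 := mul_le_mul_of_nonneg_right (defB a b r hr h) hK1
    refine h1.trans ?_
    have h2 : (2*a-r)*N ≤ 2*a*(N-r) := by nlinarith
    have h3 : (2*a-r+2)*(N+1) ≤ 2*(a+1)*(N-r+1) := by nlinarith
    have h4 : 0 ≤ (2*a-r+2)*(N+1) := by apply mul_nonneg <;> linarith
    have h5 : 0 ≤ 2*a*(N-r) := by apply mul_nonneg <;> linarith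
    have := mul_le_mul h2 h3 h4 h5
    nlinarith

lemma ineqZ {ι : Type*} [Fintype ι] [DecidableEq ι] [Nontrivial ι] (N r : ℤ) (a b : ι → ℤ)
    (hr1 : 1 ≤ r) (hrN : r ≤ N) (ha : ∀ i, 1 ≤ a i) (hb : ∀ i, 0 ≤ b i)
    (hba : ∀ i, b i ≤ a i) (hbr : ∀ i, 2 * b i ≤ r) (hpair : ∀ i j, i ≠ j → a i + a j ≤ N)
    (hind : ∀ i, r ≤ 2 * (N - a i)) (hsum : N*(N+1) ≤ ∑ i, a i * (a i + 1)) :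
    N*(N+1) - (N-r)*(N-r+1) ≤ ∑ i, (2*(a i - b i)*(r - b i) + b i * (b i + 1)) := by
  set d : ι → ℤ := fun i => 4*(a i*(a i+1) - 2*(a i-b i)*(r-b i) - b i*(b i+1)) with hd
  set X := ∑ i, a i * (a i + 1) with hX
  have key : ∑ i, d i = 4 * X - 4 * ∑ i, (2*(a i - b i)*(r - b i) + b i * (b i + 1)) := by
    rw [hX, ← mul_sub, ← Finset.sum_sub_distrib, Finset.mul_sum]
    apply Finset.sum_congr rfl; intro i _; simp only [hd]; ring
  suffices h : ∑ i, d i ≤ 4 * X - 4*(N*(N+1)) + 4*((N-r)*(N-r+1)) by linarith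
  by_cases hA : ∀ i, 2 * a i + 1 ≤ N
  · have h1 : (∑ i, d i) * (N*(N+1)) ≤ 4 * X * ((N-r)*(N-r+1)) := by
      rw [Finset.sum_mul, hX, Finset.mul_sum, Finset.sum_mul]
      exact Finset.sum_le_sum fun i _ =>
        ratioN _ _ _ _ (hb i) (hba i) (hbr i) (hA i) hrN (by linarith)
    have hN : 0 < N*(N+1) := by nlinarith
    refine le_of_mul_le_mul_right (h1.trans ?_) hN
    have h3 : (N-r)*(N-r+1) ≤ N*(N+1) := by nlinarith
    nlinarith [mul_nonneg (sub_nonneg.2 hsum) (sub_nonneg.2 h3)]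
  push Not at hA
  obtain ⟨i0, hi0⟩ := hA
  obtain ⟨i1, hi1⟩ := exists_ne i0
  have hK0 : 1 ≤ N - a i0 := by linarith [hpair i1 i0 hi1, ha i1]
  by_cases hw : N + 1 ≤ 2 * a i0
  · obtain ⟨K, hK⟩ : ∃ K, K = N - a i0 := ⟨_, rfl⟩
    have hZ : r ≤ 2*K := by rw [hK]; exact hind i0
    rw [← Finset.add_sum_erase _ _ (Finset.mem_univ i0)]
    have hX' : X = a i0 * (a i0+1) + ∑ i ∈ Finset.univ.erase i0, a i * (a i + 1) := by
      rw [hX, ← Finset.add_sum_erase _ _ (Finset.mem_univ i0)]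
    set Y := ∑ i ∈ Finset.univ.erase i0, a i * (a i + 1)
    set E := ∑ i ∈ Finset.univ.erase i0, d i with hE
    have h1 : E * (K*(K+1)) ≤ Y * ((2*K-r)*(2*K-r+2)) := by
      rw [hE, Finset.sum_mul, Finset.sum_mul]
      refine Finset.sum_le_sum fun i hi => ?_
      have := hpair i i0 (Finset.ne_of_mem_erase hi)
      exact ratioK _ _ _ _ (hb i) (hba i) (hbr i) (by linarith) hZ (by linarith)
    have h2 : d i0 ≤ (2*a i0-r)*(2*a i0-r+2) := defB _ _ _ (hbr i0) (by linarith)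
    have hKK : 0 < K*(K+1) := by nlinarith
    rw [← hK] at hK0
    obtain ⟨w, hw'⟩ : ∃ w, w = N - 2*K := ⟨_, rfl⟩
    obtain ⟨Z, hZ'⟩ : ∃ Z, Z = 2*K - r := ⟨_, rfl⟩
    have hwpos : 1 ≤ w := by linarith
    have ea : a i0 = w + K := by linarith
    have eN : N = w + 2*K := by linarith
    have er : r = 2*K - Z := by linarith
    have hZ0 : 0 ≤ Z := by linarith
    have hZK : Z ≤ 2*K := by linarith
    rw [hX'] at hsum ⊢
    rw [ea] at hsum h2 ⊢
    rw [eN] at hsum ⊢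
    rw [er] at h1 h2 ⊢
    have e1 : 2*K-(2*K-Z) = Z := by ring
    rw [e1] at h1
    refine le_of_mul_le_mul_right (?_ : _ ≤ _ ) hKK
    have hY : K*(2*w+3*K+1) ≤ Y := by nlinarith
    have hZZ : 0 ≤ 4*(K*(K+1)) - Z*(Z+2) := by nlinarith
    have h3 := mul_nonneg (sub_nonneg.2 hY) hZZ
    have h4 := mul_le_mul_of_nonneg_right h2 hKK.le
    have h5 : 0 ≤ K*(Z * ((2*K-Z)*(w-1))) := by
      have : 0 ≤ 2*K-Z := by linarith
      have : 0 ≤ w-1 := by linarith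
      positivity
    nlinarith
  · have hN2 : N = 2 * a i0 := by linarith
    obtain ⟨K, hK⟩ : ∃ K, K = a i0 := ⟨_, rfl⟩
    rw [← hK] at hN2 hK0
    have haK : ∀ i, a i ≤ K := fun i => by
      by_cases h : i = i0
      · subst h; exact hK.ge
      · linarith [hpair i i0 h]
    have hZ : r ≤ 2*K := by have := hind i0; linarith
    obtain ⟨Z, hZ'⟩ : ∃ Z, Z = 2*K - r := ⟨_, rfl⟩
    have hZ0 : 0 ≤ Z := by linarith
    have hZK : Z + 1 ≤ 2*K := by linarith
    subst hN2
    have er : r = 2*K - Z := by linarith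
    have e1 : 2*K - r = Z := by linarith
    rw [e1]
    rcases le_or_gt Z 1 with hZ1 | hZ1
    · have : ∑ i, d i ≤ 0 := by
        refine Finset.sum_nonpos fun i _ => ?_
        by_cases h : 2 * a i ≤ r
        · exact defA _ _ _ (hb i) (hba i) (hbr i) h
        · have := haK i
          exact defC _ _ _ (hbr i) (by omega)
      nlinarith
    have hK2 : 2 ≤ K := by linarith
    set s := Finset.univ.filter (fun i => a i = K) with hs
    set t := Finset.univ.filter (fun i => ¬ a i = K) with ht
    have hsplit := Finset.sum_filter_add_sum_filter_not Finset.univ (fun i => a i = K) d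
    have hsplitX := Finset.sum_filter_add_sum_filter_not Finset.univ (fun i => a i = K) (fun i => a i * (a i+1))
    rw [← hs, ← ht] at hsplit hsplitX
    rw [← hX] at hsplitX
    have hsX : ∑ i ∈ s, a i * (a i+1) = s.card * (K*(K+1)) := by
      rw [Finset.sum_congr rfl (g := fun _ => K*(K+1)), Finset.sum_const, nsmul_eq_mul]
      intro i hi; rw [(Finset.mem_filter.1 hi).2]
    have hsd : ∑ i ∈ s, d i ≤ s.card * (Z*(Z+2)) := by
      rw [← nsmul_eq_mul]
      refine Finset.sum_le_card_nsmul _ _ _ fun i hi => ?_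
      have h := (Finset.mem_filter.1 hi).2
      have := defB (a i) (b i) r (hbr i) (by rw [h]; exact hZ)
      rw [h] at this
      simp only [hd]
      rw [h, hZ']; exact this
    set Y := ∑ i ∈ t, a i * (a i + 1)
    rw [hsX] at hsplitX
    rw [← hsplit, ← hsplitX]
    rw [← hsplitX] at hsum
    rcases le_or_gt 4 s.card with hj | hj
    · have htd : ∑ i ∈ t, d i ≤ 4 * Y := by
        rw [Finset.mul_sum]
        exact Finset.sum_le_sum fun i _ => defD _ _ _ (hb i) (hba i) (hbr i)
      have hj' : (4:ℤ) ≤ s.card := by exact_mod_cast hj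
      have hZZ : 0 ≤ 4*(K*(K+1)) - Z*(Z+2) := by nlinarith
      nlinarith [mul_nonneg (sub_nonneg.2 hj') hZZ]
    · have hj' : (s.card:ℤ) ≤ 3 := by exact_mod_cast (by omega : s.card ≤ 3)
      have htd : (∑ i ∈ t, d i) * ((K-1)*K) ≤ Y * ((Z-2)*Z) := by
        rw [Finset.sum_mul, Finset.sum_mul]
        refine Finset.sum_le_sum fun i hi => ?_
        have h := (Finset.mem_filter.1 hi).2
        have h' := haK i
        have := ratioK (a i) (b i) r (K-1) (hb i) (hba i) (hbr i) (by omega) (by linarith) (by linarith)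
        have e2 : 2*(K-1) - r = Z-2 := by linarith
        rw [e2] at this
        calc d i * ((K-1)*K) = _ := by simp only [hd]; ring
          _ ≤ _ := this
          _ = _ := by ring
      have hKK : 0 < (K-1)*K := by nlinarith
      refine le_of_mul_le_mul_right (?_ : _ ≤ _ ) hKK
      have h4 := mul_le_mul_of_nonneg_right hsd hKK.le
      generalize (s.card : ℤ) = j at *
      have hZZ : 0 ≤ 4*((K-1)*K) - Z*(Z-2) := by nlinarith
      have hY : 2*K*(2*K+1) - j*(K*(K+1)) ≤ Y := by linarith
      have h3 := mul_nonneg (sub_nonneg.2 hY) hZZ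
      have h5 : 0 ≤ (3-j)*(K*(Z*(2*K-Z))) := by
        have : 0 ≤ 2*K-Z := by linarith
        have : 0 ≤ 3-j := by linarith
        positivity
      generalize ∑ i ∈ s, d i = Sd at h4 ⊢
      generalize ∑ i ∈ t, d i = Td at htd ⊢
      clear_value Y
      clear hsplit hsplitX hsX hsd key
      linarith only [h3, h4, h5, htd]

open Module in
lemma rn_aux {F V V' : Type*} [Field F] [AddCommGroup V] [Module F V] [AddCommGroup V']
    [Module F V'] [FiniteDimensional F V] (f : V →ₗ[F] V') (M : Submodule F V) :
    finrank F (M.map f) + finrank F (M ⊓ LinearMap.ker f : Submodule F V) = finrank F M := by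
  rw [← LinearMap.finrank_range_add_finrank_ker (f.domRestrict M), LinearMap.range_domRestrict]
  congr 1
  rw [LinearMap.ker_domRestrict, ← Submodule.map_comap_subtype]
  exact (LinearEquiv.finrank_eq
    (Submodule.equivMapOfInjective _ (Submodule.injective_subtype M) _)).symm

lemma ncard_fiber {α β : Type*} [Finite α] [Finite β] (A : Set α) (T : Set β) (f : α → β) (X : ℕ)
    (hf : ∀ x ∈ A, f x ∈ T) (hX : ∀ y ∈ T, {x ∈ A | f x = y}.ncard ≤ X) :
    A.ncard ≤ T.ncard * X := by
  classical
  have := Fintype.ofFinite α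
  have := Fintype.ofFinite β
  rw [Set.ncard_eq_toFinset_card' A, Set.ncard_eq_toFinset_card' T, mul_comm]
  refine Finset.card_le_mul_card_image_of_maps_to (f := f) (by simpa using hf) X ?_
  intro y hy
  refine le_trans (le_of_eq ?_) (hX y (by simpa using hy))
  rw [Set.ncard_eq_toFinset_card']
  congr 1
  ext; simp

lemma quad_roots {F : Type*} [Field F] (a b c : F) (ha : a ≠ 0) :
    {t : F | a * t^2 + b * t + c = 0}.ncard ≤ 2 := by
  classical
  set P : Polynomial F := Polynomial.C a * Polynomial.X^2 + Polynomial.C b * Polynomial.X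
    + Polynomial.C c with hP
  have hP0 : P ≠ 0 := by
    intro h
    have := congrArg (fun q => Polynomial.coeff q 2) h
    simp [hP, Polynomial.coeff_X, Polynomial.coeff_C] at this
    exact ha this
  have h1 : {t : F | a * t^2 + b * t + c = 0} ⊆ (P.roots.toFinset : Set F) := by
    intro t ht
    simp only [Finset.mem_coe, Multiset.mem_toFinset, Polynomial.mem_roots hP0,
      Polynomial.IsRoot.def]
    simpa [hP] using ht
  calc _ ≤ (P.roots.toFinset : Set F).ncard := Set.ncard_le_ncard h1
    _ = P.roots.toFinset.card := Set.ncard_coe_finset _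
    _ ≤ P.roots.card := Multiset.toFinset_card_le _
    _ ≤ P.natDegree := Polynomial.card_roots' _
    _ ≤ 2 := Polynomial.natDegree_quadratic_le

set_option linter.unusedSectionVars false
section DP
open Module

variable {F V : Type*} [Field F] [Finite F] [AddCommGroup V] [Module F V] [FiniteDimensional F V]

lemma zero_count (B : V →ₗ[F] V →ₗ[F] F) (M : Submodule F V)
    (m : V) (hm : m ∈ M) (hmm : B m m ≠ 0) :
    {v | v ∈ M ∧ B v v = 0}.ncard * Nat.card F ≤ 2 * Nat.card M := by
  have : Finite V := Module.finite_of_finite F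
  set P : Set (V × F) := {x | x.1 ∈ M ∧ B (x.1 + x.2 • m) (x.1 + x.2 • m) = 0} with hP
  have h1 : ({v | v ∈ M ∧ B v v = 0} ×ˢ (Set.univ : Set F)).ncard ≤ P.ncard := by
    refine Set.ncard_le_ncard_of_injOn (fun x => (x.1 - x.2 • m, x.2)) ?_ ?_
    · rintro ⟨v, t⟩ ⟨⟨hv, hv'⟩, -⟩
      refine ⟨M.sub_mem hv (M.smul_mem _ hm), ?_⟩
      simpa using hv'
    · rintro ⟨v, t⟩ - ⟨v', t'⟩ - h
      simp only [Prod.mk.injEq] at h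
      obtain ⟨h1, rfl⟩ := h
      simpa using h1
  rw [Set.ncard_prod, Set.ncard_univ] at h1
  refine h1.trans ?_
  have h2 := ncard_fiber P (M : Set V) Prod.fst 2 (fun x hx => hx.1) ?_
  · rw [mul_comm]; exact h2
  · intro v _
    refine le_trans ?_ (quad_roots (B m m) (B v m + B m v) (B v v) hmm)
    refine Set.ncard_le_ncard_of_injOn Prod.snd ?_ ?_
    · rintro ⟨v', t⟩ ⟨⟨_, h⟩, h'⟩
      obtain rfl : v' = v := h'
      simp only [map_add, map_smul, LinearMap.add_apply, LinearMap.smul_apply, smul_eq_mul] at h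
      simp only [Set.mem_ofPred_eq]
      linear_combination h
    · rintro ⟨v1, t⟩ ⟨_, h1⟩ ⟨v2, t'⟩ ⟨_, h2⟩ h
      simp only at h1 h2 h
      rw [h1, h2, h]

/-- isotropic `a`-tuples whose image in the dual has rank `b` -/
def isoSet (B : V →ₗ[F] V →ₗ[F] F) (a b : ℕ) : Set (Fin a → V) :=
  {w | (∀ k l, B (w k) (w l) = 0) ∧
    finrank F (Submodule.span F (Set.range fun k => B (w k))) = b}

lemma isoSet_le (B : V →ₗ[F] V →ₗ[F] F) (a b : ℕ) (h : (isoSet B a b).Nonempty) : b ≤ a := by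
  obtain ⟨w, -, rfl⟩ := h
  have := finrank_range_le_card (R := F) (fun k => B (w k))
  rw [Fintype.card_fin] at this
  exact this

lemma ker_le_coann (B : V →ₗ[F] V →ₗ[F] F) (hB : ∀ x y, B x y = B y x) (U : Submodule F V) :
    LinearMap.ker B ≤ (U.map B).dualCoannihilator := by
  intro v hv
  rw [Submodule.mem_dualCoannihilator]
  rintro _ ⟨u, -, rfl⟩
  rw [hB, LinearMap.mem_ker.1 hv]; rfl

lemma iso_two (B : V →ₗ[F] V →ₗ[F] F) (hB : ∀ x y, B x y = B y x) (U : Submodule F V)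
    (hU : ∀ x ∈ U, ∀ y ∈ U, B x y = 0) :
    2 * finrank F (U.map B) ≤ finrank F (LinearMap.range B) := by
  have h1 : finrank F (U.map B) + finrank F (U.map B).dualCoannihilator = finrank F V :=
    Subspace.finrank_add_finrank_dualCoannihilator_eq (U.map B)
  have h2 := rn_aux B (U.map B).dualCoannihilator
  rw [inf_eq_right.2 (ker_le_coann B hB U)] at h2
  have h3 := LinearMap.finrank_range_add_finrank_ker B
  have h4 : U.map B ≤ (U.map B).dualCoannihilator.map B := by
    apply Submodule.map_mono
    intro u hu
    rw [Submodule.mem_dualCoannihilator]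
    rintro _ ⟨v, hv, rfl⟩
    exact hU v hv u hu
  have h5 := Submodule.finrank_mono h4
  omega

lemma iso_dim (B : V →ₗ[F] V →ₗ[F] F) (U : Submodule F V)
    (hU : ∀ x ∈ U, ∀ y ∈ U, B x y = 0) :
    finrank F (LinearMap.range B) + 2 * finrank F U ≤ 2 * finrank F V := by
  have h1 : finrank F U + finrank F U.dualAnnihilator = finrank F V :=
    Subspace.finrank_add_finrank_dualAnnihilator_eq U
  have h2 := rn_aux B U
  have h3 := LinearMap.finrank_range_add_finrank_ker B
  have h4 : U.map B ≤ U.dualAnnihilator := by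
    rintro _ ⟨v, hv, rfl⟩
    rw [Submodule.mem_dualAnnihilator]
    exact fun u hu => hU v hv u hu
  have h5 : finrank F (U.map B) ≤ finrank F U.dualAnnihilator := Submodule.finrank_mono h4
  have h6 := Submodule.finrank_mono (inf_le_right : U ⊓ LinearMap.ker B ≤ _)
  omega

lemma span_iso {κ : Type*} (B : V →ₗ[F] V →ₗ[F] F) (w : κ → V) (h : ∀ k l, B (w k) (w l) = 0) :
    ∀ x ∈ Submodule.span F (Set.range w), ∀ y ∈ Submodule.span F (Set.range w), B x y = 0 := by
  intro x hx y hy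
  induction hx, hy using Submodule.span_induction₂ with
  | mem_mem x y hx hy =>
    obtain ⟨k, rfl⟩ := hx
    obtain ⟨l, rfl⟩ := hy
    exact h k l
  | zero_left => simp
  | zero_right => simp
  | add_left x y z _ _ _ h1 h2 => simp [h1, h2]
  | add_right x y z _ _ _ h1 h2 => simp [h1, h2]
  | smul_left r x y _ _ h => simp [h]
  | smul_right r x y _ _ h => simp [h]

lemma isoSet_two (B : V →ₗ[F] V →ₗ[F] F) (hB : ∀ x y, B x y = B y x) (a b : ℕ)
    (h : (isoSet B a b).Nonempty) : 2 * b ≤ finrank F (LinearMap.range B) := by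
  obtain ⟨w, hw, rfl⟩ := h
  have := iso_two B hB _ (span_iso B w hw)
  rwa [Submodule.map_span, ← Set.range_comp] at this

lemma comap_card (B : V →ₗ[F] V →ₗ[F] F) (P : Submodule F (V →ₗ[F] F)) :
    {v | B v ∈ P}.ncard ≤
      Nat.card F ^ (finrank F (LinearMap.ker B) + finrank F P) := by
  have : Finite F := inferInstance
  have h1 : {v | B v ∈ P}.ncard = Nat.card (P.comap B) := rfl
  rw [h1, Module.natCard_eq_pow_finrank (K := F)]
  apply Nat.pow_le_pow_right Nat.card_pos
  have h2 := rn_aux B (P.comap B)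
  have h3 := Submodule.finrank_mono (Submodule.map_comap_le B P)
  have h4 := Submodule.finrank_mono (inf_le_right : P.comap B ⊓ LinearMap.ker B ≤ _)
  omega

lemma perp_card (h2 : (2 : F) ≠ 0) (B : V →ₗ[F] V →ₗ[F] F) (hB : ∀ x y, B x y = B y x)
    (P : Submodule F (Dual F V)) (b : ℕ) (hb : finrank F P = b) :
    {v | v ∈ P.dualCoannihilator ∧ B v v = 0 ∧ B v ∉ P}.ncard ≤
      2 * Nat.card F ^ (finrank F V - (b + 1)) ∧
    ({v | v ∈ P.dualCoannihilator ∧ B v v = 0 ∧ B v ∉ P}.Nonempty → b + 1 ≤ finrank F V) := by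
  have : Finite V := Module.finite_of_finite F
  by_cases hne : {v | v ∈ P.dualCoannihilator ∧ B v v = 0 ∧ B v ∉ P}.Nonempty
  swap
  · rw [Set.not_nonempty_iff_eq_empty] at hne
    rw [hne]; simp
  obtain ⟨v, hv, hvv, hvP⟩ := hne
  have h3 : ∃ m ∈ P.dualCoannihilator, B v m ≠ 0 := by
    by_contra hcon
    push Not at hcon
    apply hvP
    rw [← Subspace.dualCoannihilator_dualAnnihilator_eq (W := P), Submodule.mem_dualAnnihilator]
    exact hcon
  obtain ⟨m, hm, hvm⟩ := h3
  have h4 : ∃ m ∈ P.dualCoannihilator, B m m ≠ 0 := by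
    by_contra hcon
    push Not at hcon
    have e1 := hcon _ (P.dualCoannihilator.add_mem hv hm)
    have e2 := hcon _ hm
    simp only [map_add, LinearMap.add_apply, e2, hvv, hB m v] at e1
    apply hvm
    have : (2:F) * B v m = 0 := by linear_combination e1
    exact (mul_eq_zero.1 this).resolve_left h2
  obtain ⟨m, hm, hmm⟩ := h4
  have h5 := zero_count B P.dualCoannihilator m hm hmm
  have h6 := Subspace.finrank_add_finrank_dualCoannihilator_eq P
  have h7 : 0 < finrank F P.dualCoannihilator := by
    rw [Module.finrank_pos_iff]
    refine ⟨⟨m, hm⟩, 0, ?_⟩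
    intro h
    apply hmm
    have : m = 0 := congrArg Subtype.val h
    simp [this]
  refine ⟨?_, fun _ => by omega⟩
  rw [Module.natCard_eq_pow_finrank (K := F) (V := P.dualCoannihilator)] at h5
  have e : finrank F P.dualCoannihilator = finrank F V - (b+1) + 1 := by omega
  rw [e, pow_succ, ← mul_assoc] at h5
  refine le_trans (Set.ncard_le_ncard ?_) (Nat.le_of_mul_le_mul_right h5 Nat.card_pos)
  exact fun v hv => ⟨hv.1, hv.2.1⟩

lemma iso_step (h2 : (2 : F) ≠ 0) (B : V →ₗ[F] V →ₗ[F] F) (hB : ∀ x y, B x y = B y x) (a b : ℕ) :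
    (isoSet B (a+1) b).ncard ≤ (isoSet B a b).ncard *
        Nat.card F ^ (finrank F (LinearMap.ker B) + b) +
      (if b = 0 then 0 else (isoSet B a (b-1)).ncard *
        (if b ≤ finrank F V then 2 * Nat.card F ^ (finrank F V - b) else 0)) := by
  have : Finite V := Module.finite_of_finite F
  set p : (Fin (a+1) → V) → Submodule F (V →ₗ[F] F) := fun w =>
    Submodule.span F (Set.range fun k : Fin a => B (w k.castSucc)) with hp
  have hspan : ∀ w : Fin (a+1) → V, Submodule.span F (Set.range fun k => B (w k)) =
      p w ⊔ Submodule.span F {B (w (Fin.last a))} := by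
    intro w
    rw [hp, ← Submodule.span_union]
    congr 1
    ext x
    simp only [Set.mem_range, Set.mem_union, Set.mem_singleton_iff]
    constructor
    · rintro ⟨k, rfl⟩
      induction k using Fin.lastCases with
      | last => right; rfl
      | cast k => left; exact ⟨k, rfl⟩
    · rintro (⟨k, rfl⟩ | rfl)
      · exact ⟨_, rfl⟩
      · exact ⟨_, rfl⟩
  set A1 := {w ∈ isoSet B (a+1) b | B (w (Fin.last a)) ∈ p w}
  set A2 := {w ∈ isoSet B (a+1) b | B (w (Fin.last a)) ∉ p w}
  have hA : isoSet B (a+1) b ⊆ A1 ∪ A2 := by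
    intro w hw
    by_cases h : B (w (Fin.last a)) ∈ p w
    · left; exact ⟨hw, h⟩
    · right; exact ⟨hw, h⟩
  have inj : ∀ y : Fin a → V, Set.InjOn (fun w : Fin (a+1) → V => w (Fin.last a))
      {w | Fin.init w = y} := by
    intro y w hw w' hw' h
    rw [← Fin.snoc_init_self w, ← Fin.snoc_init_self w', hw, hw']
    exact congrArg _ h
  refine (Set.ncard_le_ncard hA).trans ((Set.ncard_union_le _ _).trans (add_le_add ?_ ?_))
  · refine ncard_fiber A1 (isoSet B a b) Fin.init _ ?_ ?_
    · rintro w ⟨⟨h1, h3⟩, h4⟩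
      refine ⟨fun k l => h1 _ _, ?_⟩
      rw [hspan, sup_eq_left.2 (by rwa [Submodule.span_singleton_le_iff_mem])] at h3
      exact h3
    · rintro y ⟨-, hy⟩
      have := comap_card B (Submodule.span F (Set.range fun k => B (y k)))
      rw [hy] at this
      refine le_trans (Set.ncard_le_ncard_of_injOn (fun w => w (Fin.last a)) ?_ ?_) this
      · rintro w ⟨⟨-, h4⟩, rfl⟩
        exact h4
      · exact (inj y).mono fun w hw => hw.2
  · have hlt : ∀ w ∈ A2, finrank F (p w) + 1 = b := by
      rintro w ⟨⟨h1, h3⟩, h4⟩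
      rw [hspan] at h3
      have h5 : p w < p w ⊔ Submodule.span F {B (w (Fin.last a))} := by
        rw [left_lt_sup, Submodule.span_singleton_le_iff_mem]; exact h4
      have h6 := Submodule.finrank_lt_finrank_of_lt h5
      have h7 := Submodule.finrank_add_le_finrank_add_finrank (p w)
        (Submodule.span F {B (w (Fin.last a))})
      have h8 : finrank F (Submodule.span F {B (w (Fin.last a))}) ≤ 1 :=
        (finrank_span_le_card _).trans (by simp)
      omega
    split_ifs with hb0 hbN
    · rw [Nat.le_zero, Set.ncard_eq_zero]
      ext w
      simp only [Set.mem_empty_iff_false, iff_false]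
      intro hw
      have := hlt w hw
      omega
    all_goals
      refine ncard_fiber A2 (isoSet B a (b-1)) Fin.init _ ?_ ?_
      · intro w hw
        have := hlt w hw
        exact ⟨fun k l => hw.1.1 _ _, by change finrank F (p w) = _; omega⟩
      · rintro y ⟨-, hy⟩
        have hP := perp_card h2 B hB _ _ hy
        have hb1 : b - 1 + 1 = b := by omega
        rw [hb1] at hP
        have hmaps : ∀ w ∈ {x ∈ A2 | Fin.init x = y}, w (Fin.last a) ∈
            {v | v ∈ (Submodule.span F (Set.range fun k => B (y k))).dualCoannihilator ∧
              B v v = 0 ∧ B v ∉ Submodule.span F (Set.range fun k => B (y k))} := by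
          rintro w ⟨⟨⟨h1, -⟩, h4⟩, rfl⟩
          refine ⟨?_, h1 _ _, h4⟩
          rw [Submodule.mem_dualCoannihilator]
          intro φ hφ
          induction hφ using Submodule.span_induction with
          | mem x hx => obtain ⟨k, rfl⟩ := hx; exact h1 _ _
          | zero => rfl
          | add x y _ _ h h' => rw [LinearMap.add_apply, h, h', add_zero]
          | smul r x _ h => rw [LinearMap.smul_apply, h, smul_zero]
        first
        | refine le_trans (Set.ncard_le_ncard_of_injOn (fun w => w (Fin.last a)) hmaps ?_) hP.1
          exact (inj y).mono fun w hw => hw.2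
        | rw [Nat.le_zero, Set.ncard_eq_zero]
          ext w
          simp only [Set.mem_empty_iff_false, iff_false]
          intro hw
          exact hbN (hP.2 ⟨_, hmaps w hw⟩)

lemma iso_bound (h2 : (2 : F) ≠ 0) (B : V →ₗ[F] V →ₗ[F] F) (hB : ∀ x y, B x y = B y x) (a : ℕ) :
    ∀ b x, a = b + x → (isoSet B a b).ncard *
      Nat.card F ^ (x * finrank F (LinearMap.range B) + (b+1).choose 2) ≤
      3 ^ a * Nat.card F ^ (a * finrank F V + x * b) := by
  have : Finite V := Module.finite_of_finite F
  set q := Nat.card F with hq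
  have hq0 : 0 < q := Nat.card_pos
  set N := finrank F V with hN
  set ρ := finrank F (LinearMap.range B) with hρ
  have hker : ρ + finrank F (LinearMap.ker B) = N := LinearMap.finrank_range_add_finrank_ker B
  induction a with
  | zero =>
    intro b x h
    obtain ⟨rfl, rfl⟩ : b = 0 ∧ x = 0 := by omega
    simp only [zero_mul, zero_add, pow_zero, mul_one]
    have := Set.ncard_le_ncard (Set.subset_univ (isoSet B 0 0))
    rw [Set.ncard_univ] at this
    simpa using this
  | succ a ih =>
    intro b x h
    have hs := Nat.mul_le_mul_right (q ^ (x * ρ + (b+1).choose 2)) (iso_step h2 B hB a b)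
    refine hs.trans ?_
    rw [add_mul]
    have t1 : (isoSet B a b).ncard * q ^ (finrank F (LinearMap.ker B) + b) *
        q ^ (x * ρ + (b+1).choose 2) ≤ 3^a * q ^ ((a+1) * N + x * b) := by
      rcases Nat.eq_zero_or_pos x with hx | hx
      · have : isoSet B a b = ∅ := by
          rw [← Set.not_nonempty_iff_eq_empty]
          intro h'
          have := isoSet_le B a b h'
          omega
        rw [this]; simp
      · obtain ⟨x, rfl⟩ : ∃ x', x = x' + 1 := ⟨x-1, by omega⟩
        have := Nat.mul_le_mul_right (q ^ (N + b)) (ih b x (by omega))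
        calc _ = (isoSet B a b).ncard * q ^ (x * ρ + (b+1).choose 2) * q ^ (N + b) := by
              rw [← hker]; ring
          _ ≤ _ := this
          _ = _ := by ring
    have t2 : (if b = 0 then 0 else (isoSet B a (b-1)).ncard *
        (if b ≤ N then 2 * q ^ (N - b) else 0)) *
        q ^ (x * ρ + (b+1).choose 2) ≤ 2 * 3^a * q ^ ((a+1) * N + x * b) := by
      split_ifs with h0 h1
      · simp
      · obtain ⟨b, rfl⟩ : ∃ x', b = x' + 1 := ⟨b-1, by omega⟩
        obtain ⟨M, hM⟩ : ∃ M, N = M + (b+1) := ⟨N - (b+1), by omega⟩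
        have := Nat.mul_le_mul_right (2 * q ^ N) (ih b x (by omega))
        have hc : (b+1+1).choose 2 = (b+1).choose 2 + (b+1) := by
          rw [Nat.choose_succ_succ' (b+1) 1]; simp; ring
        have e : N - (b+1) = M := by omega
        rw [e, hc, Nat.add_sub_cancel]
        calc _ = (isoSet B a b).ncard * q ^ (x * ρ + (b+1).choose 2) * (2 * q ^ N) := by
              rw [hM]; ring
          _ ≤ _ := this
          _ = 2 * 3 ^ a * q ^ ((a+1) * N + x * b) := by ring
          _ ≤ _ := by
            apply Nat.mul_le_mul_left
            apply Nat.pow_le_pow_right hq0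
            nlinarith
      · simp
    calc _ ≤ 3^a * q ^ ((a+1) * N + x * b) + 2 * 3^a * q ^ ((a+1) * N + x * b) := add_le_add t1 t2
      _ = _ := by ring

end DP

section SymCount
variable {F : Type*} [Field F] {N : ℕ}

/-- the rows in `R` span the row space -/
def goodRows (S : Matrix (Fin N) (Fin N) F) (R : Finset (Fin N)) : Prop :=
  R.card = S.rank ∧ ∀ k, S k ∈ Submodule.span F (S '' (R : Set (Fin N)))

lemma exists_goodRows (S : Matrix (Fin N) (Fin N) F) : ∃ R, goodRows S R := by
  classical
  obtain ⟨κ, f, hf, hspan, hli⟩ := exists_linearIndependent' F (fun k => S k)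
  have : Fintype κ := Fintype.ofInjective f hf
  refine ⟨Finset.univ.image f, ?_, ?_⟩
  · rw [Finset.card_image_of_injective _ hf, Matrix.rank_eq_finrank_span_row,
      Finset.card_univ, ← finrank_span_eq_card hli, hspan]
    rfl
  · intro k
    have h : S '' ((Finset.univ.image f : Finset (Fin N)) : Set (Fin N)) =
        Set.range ((fun k => S k) ∘ f) := by
      rw [Finset.coe_image, Finset.coe_univ, Set.image_univ, Set.range_comp]
    rw [h, hspan]
    exact Submodule.subset_span ⟨k, rfl⟩

lemma goodRows_unique (S S' : Matrix (Fin N) (Fin N) F) (hS : S.IsSymm) (hS' : S'.IsSymm)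
    (R : Finset (Fin N)) (h : goodRows S R) (h' : goodRows S' R)
    (heq : ∀ i ∈ R, ∀ j, S i j = S' i j) : S = S' := by
  have himg : S '' (R : Set (Fin N)) = S' '' (R : Set (Fin N)) :=
    Set.image_congr fun i hi => funext fun j => heq i hi j
  have hx : ∀ k, S k - S' k ∈ Submodule.span F (Set.range S) := by
    intro k
    refine Submodule.sub_mem _ (Submodule.subset_span ⟨k, rfl⟩) ?_
    have := h'.2 k
    rw [← himg] at this
    exact Submodule.span_mono (Set.image_subset_range _ _) this
  ext k l
  obtain ⟨c, hc⟩ := (Submodule.mem_span_range_iff_exists_fun F).1 (hx k)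
  have hcl : ∀ l, S k l - S' k l = S l ⬝ᵥ c := by
    intro l
    have := congrFun hc l
    rw [Finset.sum_apply] at this
    rw [← Pi.sub_apply (S k) (S' k), ← this, dotProduct]
    refine Finset.sum_congr rfl fun i _ => ?_
    rw [Pi.smul_apply, smul_eq_mul, mul_comm, hS.apply]
  have hR : ∀ m ∈ R, S m ⬝ᵥ c = 0 := by
    intro m hm
    rw [← hcl, ← hS.apply, ← hS'.apply, heq m hm, sub_self]
  have hz' : ∀ y ∈ Submodule.span F (S '' (R : Set (Fin N))), y ⬝ᵥ c = 0 := by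
    intro y hy
    induction hy using Submodule.span_induction with
    | mem x hx => obtain ⟨m, hm, rfl⟩ := hx; exact hR m hm
    | zero => exact zero_dotProduct _
    | add x y _ _ h1 h2 => rw [add_dotProduct, h1, h2, add_zero]
    | smul r x _ h1 => rw [smul_dotProduct, h1, smul_zero]
  have hz : S l ⬝ᵥ c = 0 := hz' _ (h.2 l)
  have := hcl l
  rw [hz] at this
  exact sub_eq_zero.1 this

lemma sym_count [Finite F] (ρ E : ℕ) (hρ : ρ ≤ N)
    (hE : E + (N - ρ + 1).choose 2 = (N + 1).choose 2) :
    {S : Matrix (Fin N) (Fin N) F | S.IsSymm ∧ S.rank = ρ}.ncard ≤ 2 ^ N * Nat.card F ^ E := by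
  classical
  have : Finite (Matrix (Fin N) (Fin N) F) := inferInstanceAs (Finite (Fin N → Fin N → F))
  choose rows hrows using exists_goodRows (F := F) (N := N)
  have hT : (Set.univ : Set (Finset (Fin N))).ncard = 2 ^ N := by
    rw [Set.ncard_univ]; simp
  rw [← hT]
  refine ncard_fiber _ _ rows _ (fun _ _ => Set.mem_univ _) ?_
  intro R _
  rcases Set.eq_empty_or_nonempty
    {x ∈ {S : Matrix (Fin N) (Fin N) F | S.IsSymm ∧ S.rank = ρ} | rows x = R} with he | ⟨S0, h0, h0'⟩
  · rw [he]; simp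
  have hRc : R.card = ρ := by rw [← h0', (hrows S0).1, h0.2]
  set D : Finset (Sym2 (Fin N)) := Finset.univ.sym2 \ Rᶜ.sym2 with hD
  have hDc : D.card = E := by
    rw [hD, Finset.card_sdiff_of_subset (Finset.sym2_mono (Finset.subset_univ _)),
      Finset.card_sym2, Finset.card_sym2, Finset.card_compl, hRc, Finset.card_univ,
      Fintype.card_fin]
    omega
  have hcard : (Set.univ : Set (D → F)).ncard = Nat.card F ^ E := by
    rw [Set.ncard_univ, Nat.card_fun, Nat.card_eq_fintype_card (α := D), Fintype.card_coe, hDc]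
  rw [← hcard]
  refine Set.ncard_le_ncard_of_injOn
    (fun S => fun e : D => S (Quot.out e.1).1 (Quot.out e.1).2) (fun _ _ => Set.mem_univ _) ?_
  rintro S ⟨⟨hS, -⟩, hSR⟩ S' ⟨⟨hS', -⟩, hSR'⟩ heq
  refine goodRows_unique S S' hS hS' R (hSR ▸ hrows S) (hSR' ▸ hrows S') ?_
  intro i hi j
  have hmem : s(i, j) ∈ D := by
    rw [hD, Finset.mem_sdiff]
    simp [hi]
  have h1 := congrFun heq ⟨_, hmem⟩
  simp only at h1
  have h2 : s((Quot.out s(i,j)).1, (Quot.out s(i,j)).2) = s(i,j) := Quot.out_eq s(i,j)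
  rcases Sym2.eq_iff.1 h2 with ⟨e1, e2⟩ | ⟨e1, e2⟩
  · rw [e1, e2] at h1; exact h1
  · rw [e1, e2] at h1; rw [← hS.apply, ← hS'.apply]; exact h1

end SymCount

section Count
variable {F : Type*} [Field F] [Finite F] {N : ℕ}

lemma double_count {X Y : Type*} [Finite X] [Finite Y] (Bad : Set X) (Ys : Set Y)
    (R : X → Y → Prop) (m L : ℕ) (h1 : ∀ x ∈ Bad, m ≤ {y ∈ Ys | R x y}.ncard)
    (h2 : ∀ y ∈ Ys, {x ∈ Bad | R x y}.ncard ≤ L) : Bad.ncard * m ≤ Ys.ncard * L := by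
  classical
  have := Fintype.ofFinite X
  have := Fintype.ofFinite Y
  rw [Set.ncard_eq_toFinset_card' Bad, Set.ncard_eq_toFinset_card' Ys]
  refine Finset.card_mul_le_card_mul R ?_ ?_
  · intro x hx
    refine (h1 x (by simpa using hx)).trans (le_of_eq ?_)
    rw [Set.ncard_eq_toFinset_card']
    congr 1
    ext y; simp [Finset.bipartiteAbove]
  · intro y hy
    refine (le_of_eq ?_).trans (h2 y (by simpa using hy))
    rw [Set.ncard_eq_toFinset_card']
    congr 1
    ext y; simp [Finset.bipartiteBelow]

lemma scale_count {V : Type*} [AddCommGroup V] [Module F V] [Finite V] (y : V) (hy : y ≠ 0)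
    (P : Set V) (h : ∀ u : F, u ≠ 0 → u • y ∈ P) : Nat.card F - 1 ≤ P.ncard := by
  have h1 : ({0}ᶜ : Set F).ncard = Nat.card F - 1 := by
    rw [Set.ncard_compl, Set.ncard_singleton]
  rw [← h1]
  refine Set.ncard_le_ncard_of_injOn (fun u => u • y) (fun u hu => h u hu) ?_ (Set.toFinite _)
  intro u _ v _ huv
  exact smul_left_injective F hy huv

lemma ker_count {V W : Type*} [AddCommGroup V] [AddCommGroup W] [Finite V] [Finite W]
    (φ : V →+ W) (s : W → V) (hs : ∀ w, φ (s w) = w) :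
    {v | φ v = 0}.ncard * Nat.card W ≤ Nat.card V := by
  rw [← Nat.card_coe_set_eq, ← Nat.card_prod]
  refine Nat.card_le_card_of_injective (fun x => x.1.1 + s x.2) ?_
  rintro ⟨⟨v, hv⟩, w⟩ ⟨⟨v', hv'⟩, w'⟩ h
  have hv : φ v = 0 := hv
  have hv' : φ v' = 0 := hv'
  simp only at h
  have h1 := congrArg φ h
  rw [map_add, map_add, hv, hv', hs, hs, zero_add, zero_add] at h1
  subst h1
  have := add_right_cancel h
  subst this
  rfl

lemma dep_count {ι : Type*} [Fintype ι] [DecidableEq ι] (a : ι → ℕ) (i j : ι) (hij : i ≠ j)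
    (h : a i + a j ≤ N) :
    {w : (i : ι) → Fin (a i) → (Fin N → F) |
      ¬ LinearIndependent F (Sum.elim (w i) (w j))}.ncard * (Nat.card F - 1) ≤
      Nat.card ((i : ι) → Fin (a i) → (Fin N → F)) := by
  classical
  have hq : 0 < Nat.card F := Nat.card_pos
  set Ω := ((i : ι) → Fin (a i) → (Fin N → F))
  have key := double_count (X := Ω) (Y := (Fin (a i) ⊕ Fin (a j) → F))
    {w : Ω | ¬ LinearIndependent F (Sum.elim (w i) (w j))} {0}ᶜ
    (fun w c => ∑ k, c k • (Sum.elim (w i) (w j) k) = 0) (Nat.card F - 1)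
    (Nat.card Ω / Nat.card F ^ N) ?_ ?_
  · refine key.trans ?_
    refine le_trans (Nat.mul_le_mul_right _ ?_) (Nat.mul_div_le (Nat.card Ω) (Nat.card F ^ N))
    calc _ ≤ (Set.univ : Set (Fin (a i) ⊕ Fin (a j) → F)).ncard :=
          Set.ncard_le_ncard (Set.subset_univ _)
      _ = Nat.card F ^ (a i + a j) := by
          rw [Set.ncard_univ, Nat.card_fun]; simp
      _ ≤ _ := Nat.pow_le_pow_right hq h
  · intro w hw
    have hw : ¬ LinearIndependent F (Sum.elim (w i) (w j)) := hw
    rw [Fintype.linearIndependent_iff] at hw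
    push Not at hw
    obtain ⟨c, hc, k, hk⟩ := hw
    refine scale_count c (fun h => hk (by rw [h]; rfl)) _ ?_
    intro u hu
    refine ⟨?_, ?_⟩
    · intro h0
      have h0 : u • c = 0 := h0
      rcases smul_eq_zero.1 h0 with h0 | h0
      · exact hu h0
      · exact hk (by rw [h0]; rfl)
    · have : ∑ k, (u • c) k • (Sum.elim (w i) (w j) k) = u • ∑ k, c k • (Sum.elim (w i) (w j) k) := by
        rw [Finset.smul_sum]
        refine Finset.sum_congr rfl fun k _ => ?_
        rw [Pi.smul_apply, smul_assoc]
      rw [this, hc, smul_zero]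
  · intro c hc
    rw [Nat.le_div_iff_mul_le (pow_pos hq _)]
    let φ : Ω →+ (Fin N → F) :=
      { toFun := fun w => ∑ k, c k • (Sum.elim (w i) (w j) k)
        map_zero' := by
          have e1 : ∀ k, (0 : Ω) i k = 0 := fun _ => rfl
          have e2 : ∀ k, (0 : Ω) j k = 0 := fun _ => rfl
          simp [Fintype.sum_sum_type, e1, e2]
        map_add' := by
          intro x y
          have e1 : ∀ k, (x + y) i k = x i k + y i k := fun _ => rfl
          have e2 : ∀ k, (x + y) j k = x j k + y j k := fun _ => rfl
          simp [Fintype.sum_sum_type, e1, e2, Finset.sum_add_distrib]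
          abel }
    have hcard : Nat.card (Fin N → F) = Nat.card F ^ N := by rw [Nat.card_fun]; simp
    rw [← hcard]
    have hc : c ≠ 0 := hc
    obtain ⟨k, hk⟩ := Function.ne_iff.1 hc
    have : ∃ s : (Fin N → F) → Ω, ∀ v, φ (s v) = v := by
      rcases k with k | k
      · refine ⟨fun v => Pi.single i (Pi.single k ((c (Sum.inl k))⁻¹ • v)), fun v => ?_⟩
        simp only [φ, AddMonoidHom.coe_mk, ZeroHom.coe_mk, Fintype.sum_sum_type, Sum.elim_inl,
          Sum.elim_inr, Pi.single_eq_same, Pi.single_eq_of_ne hij.symm]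
        rw [Finset.sum_eq_single k, Pi.single_eq_same, smul_smul, mul_inv_cancel₀ hk]
        · simp
        · intro b _ hb; rw [Pi.single_eq_of_ne hb, smul_zero]
        · simp
      · refine ⟨fun v => Pi.single j (Pi.single k ((c (Sum.inr k))⁻¹ • v)), fun v => ?_⟩
        simp only [φ, AddMonoidHom.coe_mk, ZeroHom.coe_mk, Fintype.sum_sum_type, Sum.elim_inl,
          Sum.elim_inr, Pi.single_eq_same, Pi.single_eq_of_ne hij]
        rw [Finset.sum_eq_single (s := Finset.univ (α := Fin (a j))) k, Pi.single_eq_same,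
          smul_smul, mul_inv_cancel₀ hk]
        · simp
        · intro b _ hb; rw [Pi.single_eq_of_ne hb, smul_zero]
        · simp
    obtain ⟨s, hs⟩ := this
    refine le_trans (Nat.mul_le_mul_right _ ?_) (ker_count φ s hs)
    exact Set.ncard_le_ncard (fun w hw => hw.2)

/-- isotropic tuples, best stratum -/
lemma exists_stratum (h2 : (2 : F) ≠ 0) {V : Type*} [AddCommGroup V] [Module F V]
    [FiniteDimensional F V] (B : V →ₗ[F] V →ₗ[F] F) (hB : ∀ x y, B x y = B y x) (a : ℕ) :
    ∃ b x, a = b + x ∧ 2 * b ≤ Module.finrank F (LinearMap.range B) ∧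
      {w : Fin a → V | ∀ k l, B (w k) (w l) = 0}.ncard *
        Nat.card F ^ (x * Module.finrank F (LinearMap.range B) + (b + 1).choose 2) ≤
      ((a + 1) * 3 ^ a) * Nat.card F ^ (a * Module.finrank F V + x * b) := by
  classical
  have : Finite V := Module.finite_of_finite F
  set I := {w : Fin a → V | ∀ k l, B (w k) (w l) = 0} with hI
  have hI0 : (0 : Fin a → V) ∈ I := by intro k l; simp
  obtain ⟨b, hb, hmax⟩ := Finset.exists_max_image (Finset.range (a + 1))
    (fun b => (isoSet B a b).ncard) ⟨0, by simp⟩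
  have hle : I.ncard ≤ (a + 1) * (isoSet B a b).ncard := by
    have hT : ((Finset.range (a + 1) : Finset ℕ) : Set ℕ).ncard = a + 1 := by
      rw [Set.ncard_coe_finset, Finset.card_range]
    have hsub : I ⊆ ⋃ b ∈ Finset.range (a + 1), isoSet B a b := by
      intro w hw
      have hmem : w ∈ isoSet B a
        (Module.finrank F (Submodule.span F (Set.range fun k => B (w k)))) := ⟨hw, rfl⟩
      simp only [Set.mem_iUnion]
      refine ⟨_, ?_, hmem⟩
      have := isoSet_le B a _ ⟨w, hmem⟩
      exact Finset.mem_range.2 (by omega)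
    calc I.ncard ≤ (⋃ b ∈ Finset.range (a + 1), isoSet B a b).ncard :=
          Set.ncard_le_ncard hsub (Set.toFinite _)
      _ ≤ ∑ b ∈ Finset.range (a + 1), (isoSet B a b).ncard :=
          Finset.set_ncard_biUnion_le _ _
      _ ≤ ∑ _b ∈ Finset.range (a + 1), (isoSet B a b).ncard :=
          Finset.sum_le_sum fun b' hb' => hmax b' hb'
      _ = _ := by simp
  have hne : (isoSet B a b).Nonempty := by
    by_contra hne
    rw [Set.not_nonempty_iff_eq_empty] at hne
    rw [hne, Set.ncard_empty, mul_zero] at hle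
    have : 0 < I.ncard := (Set.ncard_pos (Set.toFinite _)).2 ⟨0, hI0⟩
    omega
  have hba : b ≤ a := isoSet_le B a b hne
  refine ⟨b, a - b, by omega, isoSet_two B hB a b hne, ?_⟩
  calc _ ≤ ((a + 1) * (isoSet B a b).ncard) * _ := Nat.mul_le_mul_right _ hle
    _ = (a + 1) * ((isoSet B a b).ncard * _) := by ring
    _ ≤ (a + 1) * _ := Nat.mul_le_mul_left _ (iso_bound h2 B hB a b (a - b) (by omega))
    _ = _ := by ring

/-- the bilinear form of a matrix -/
def bil (S : Matrix (Fin N) (Fin N) F) : (Fin N → F) →ₗ[F] (Fin N → F) →ₗ[F] F :=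
  (dotProductEquiv F (Fin N)).toLinearMap ∘ₗ S.mulVecLin

lemma bil_apply (S : Matrix (Fin N) (Fin N) F) (x y) : bil S x y = (S.mulVec x) ⬝ᵥ y := rfl

lemma bil_symm (S : Matrix (Fin N) (Fin N) F) (h : S.IsSymm) (x y) : bil S x y = bil S y x := by
  rw [bil_apply, bil_apply, dotProduct_comm, Matrix.dotProduct_mulVec, ← Matrix.mulVec_transpose,
    h.eq]

lemma bil_rank (S : Matrix (Fin N) (Fin N) F) :
    Module.finrank F (LinearMap.range (bil S)) = S.rank := by
  rw [bil, LinearMap.range_comp]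
  exact LinearEquiv.finrank_map_eq (dotProductEquiv F (Fin N)) _

lemma iso_prod (h2 : (2 : F) ≠ 0) {ι : Type*} [Fintype ι] [DecidableEq ι] [Nontrivial ι]
    (a : ι → ℕ) (ha : ∀ i, 1 ≤ a i) (hpair : ∀ i j, i ≠ j → a i + a j ≤ N)
    (hsum : N * (N + 1) ≤ ∑ i, a i * (a i + 1)) (ρ E : ℕ) (h1 : 1 ≤ ρ) (hρ : ρ ≤ N)
    (hE : E + (N - ρ + 1).choose 2 = (N + 1).choose 2)
    (S : Matrix (Fin N) (Fin N) F) (hS : S.IsSymm) (hr : S.rank = ρ) :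
    {w : (i : ι) → Fin (a i) → (Fin N → F) | (∀ i, LinearIndependent F (w i)) ∧
      ∀ i k l, (S.mulVec (w i k)) ⬝ᵥ (w i l) = 0}.ncard * Nat.card F ^ E ≤
    (∏ i, ((a i + 1) * 3 ^ (a i))) * Nat.card ((i : ι) → Fin (a i) → (Fin N → F)) := by
  classical
  have hq : 0 < Nat.card F := Nat.card_pos
  set G := {w : (i : ι) → Fin (a i) → (Fin N → F) | (∀ i, LinearIndependent F (w i)) ∧
      ∀ i k l, (S.mulVec (w i k)) ⬝ᵥ (w i l) = 0} with hG
  rcases Set.eq_empty_or_nonempty G with he | ⟨w0, hw0, hw0'⟩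
  · rw [he]; simp
  have hind : ∀ i, ρ + 2 * a i ≤ 2 * N := by
    intro i
    have := iso_dim (bil S) (Submodule.span F (Set.range (w0 i)))
      (span_iso (bil S) (w0 i) (fun k l => hw0' i k l))
    rw [bil_rank, hr, finrank_span_eq_card (hw0 i)] at this
    simpa using this
  have hst := fun i => exists_stratum h2 (bil S) (bil_symm S hS) (a i)
  choose b x hab hb hbound using hst
  rw [bil_rank, hr] at hb hbound
  have hle : G.ncard ≤ ∏ i, {w : Fin (a i) → (Fin N → F) | ∀ k l, bil S (w k) (w l) = 0}.ncard := by
    simp_rw [← Nat.card_coe_set_eq]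
    rw [← Nat.card_pi]
    refine Nat.card_le_card_of_injective (fun w i => ⟨w.1 i, fun k l => w.2.2 i k l⟩) ?_
    intro w w' h
    apply Subtype.ext
    funext i
    have := congrFun h i
    exact congrArg Subtype.val this
  have hcard : Nat.card ((i : ι) → Fin (a i) → (Fin N → F)) = Nat.card F ^ (∑ i, a i * N) := by
    rw [Nat.card_pi, ← Finset.prod_pow_eq_pow_sum]
    refine Finset.prod_congr rfl fun i _ => ?_
    rw [Nat.card_fun, Nat.card_fun, ← pow_mul]
    simp [mul_comm]
  have hexp : E + ∑ i, x i * b i ≤ ∑ i, (x i * ρ + (b i + 1).choose 2) := by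
    have hz := ineqZ (N : ℤ) ρ (fun i => (a i : ℤ)) (fun i => (b i : ℤ)) (by exact_mod_cast h1)
      (by exact_mod_cast hρ) (fun i => by exact_mod_cast ha i) (fun i => by positivity)
      (fun i => by have := hab i; omega) (fun i => by exact_mod_cast hb i)
      (fun i j hij => by exact_mod_cast hpair i j hij)
      (fun i => by have := hind i; omega) (by exact_mod_cast hsum)
    have hT : ∀ k : ℕ, (2 : ℤ) * ((k + 1).choose 2 : ℕ) = k * (k + 1) := by
      intro k
      have := Nat.triangle_succ k
      have h3 : (k + 1).choose 2 * 2 = (k + 1) * k := by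
        rw [Nat.choose_two_right]
        exact Nat.div_mul_cancel (Nat.even_mul_pred_self (k + 1)).two_dvd
      have h4 : (((k + 1).choose 2 * 2 : ℕ) : ℤ) = (((k + 1) * k : ℕ) : ℤ) := by rw [h3]
      push_cast at h4
      linarith
    have hE2 : (2 : ℤ) * E = N * (N + 1) - (N - ρ) * (N - ρ + 1) := by
      have e1 := hT N
      have e2 := hT (N - ρ)
      rw [Nat.cast_sub hρ] at e2
      have e3 : (E : ℤ) + ((N - ρ + 1).choose 2 : ℕ) = ((N + 1).choose 2 : ℕ) := by
        exact_mod_cast hE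
      linarith
    have hfin : (2 : ℤ) * (E + ∑ i, (x i : ℤ) * b i) ≤
        2 * ∑ i, ((x i : ℤ) * ρ + ((b i + 1).choose 2 : ℕ)) := by
      rw [mul_add, hE2]
      have : (2 : ℤ) * ∑ i, ((x i : ℤ) * ρ + ((b i + 1).choose 2 : ℕ)) =
          ∑ i, (2 * ((a i : ℤ) - b i) * (ρ - b i) + b i * (b i + 1)) + 2 * ∑ i, (x i : ℤ) * b i := by
        rw [Finset.mul_sum, Finset.mul_sum, ← Finset.sum_add_distrib]
        refine Finset.sum_congr rfl fun i _ => ?_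
        have e1 := hT (b i)
        have e2 : (a i : ℤ) = b i + x i := by exact_mod_cast hab i
        rw [e2, mul_add 2, e1]
        ring
      rw [this]
      linarith
    have := le_of_mul_le_mul_left hfin (by norm_num)
    exact_mod_cast this
  have hprod := Finset.prod_le_prod' (s := Finset.univ) (fun i _ => hbound i)
  rw [Finset.prod_mul_distrib, Finset.prod_mul_distrib, Finset.prod_pow_eq_pow_sum,
    Finset.prod_pow_eq_pow_sum, Finset.sum_add_distrib (f := fun i => a i * _)] at hprod
  have hfr : Module.finrank F (Fin N → F) = N := by simp
  rw [hfr] at hprod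
  rw [hcard]
  refine Nat.le_of_mul_le_mul_right (c := Nat.card F ^ (∑ i, x i * b i)) ?_ (pow_pos hq _)
  calc _ = G.ncard * Nat.card F ^ (E + ∑ i, x i * b i) := by rw [pow_add, mul_assoc]
    _ ≤ _ := Nat.mul_le_mul hle (Nat.pow_le_pow_right hq hexp)
    _ ≤ _ := hprod
    _ = _ := by rw [pow_add, mul_assoc]

lemma iso_count_s3 (h2 : (2 : F) ≠ 0) {ι : Type*} [Fintype ι] [DecidableEq ι] [Nontrivial ι]
    (a : ι → ℕ) (ha : ∀ i, 1 ≤ a i) (hpair : ∀ i j, i ≠ j → a i + a j ≤ N)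
    (hsum : N * (N + 1) ≤ ∑ i, a i * (a i + 1)) (ρ : ℕ) (h1 : 1 ≤ ρ) (hρ : ρ ≤ N) :
    {w : (i : ι) → Fin (a i) → (Fin N → F) | (∀ i, LinearIndependent F (w i)) ∧
      ∃ S : Matrix (Fin N) (Fin N) F, S.IsSymm ∧ S.rank = ρ ∧
      ∀ i k l, (S.mulVec (w i k)) ⬝ᵥ (w i l) = 0}.ncard * (Nat.card F - 1) ≤
    (2 ^ N * ∏ i, ((a i + 1) * 3 ^ (a i))) * Nat.card ((i : ι) → Fin (a i) → (Fin N → F)) := by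
  classical
  have hq : 0 < Nat.card F := Nat.card_pos
  have : Finite (Matrix (Fin N) (Fin N) F) := inferInstanceAs (Finite (Fin N → Fin N → F))
  set Ω := ((i : ι) → Fin (a i) → (Fin N → F))
  obtain ⟨E, hE⟩ : ∃ E, E + (N - ρ + 1).choose 2 = (N + 1).choose 2 :=
    ⟨_, Nat.sub_add_cancel (Nat.choose_le_choose 2 (by omega))⟩
  set C := ∏ i, ((a i + 1) * 3 ^ (a i)) with hC
  have key := double_count (X := Ω) (Y := Matrix (Fin N) (Fin N) F)
    {w : Ω | (∀ i, LinearIndependent F (w i)) ∧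
      ∃ S : Matrix (Fin N) (Fin N) F, S.IsSymm ∧ S.rank = ρ ∧
      ∀ i k l, (S.mulVec (w i k)) ⬝ᵥ (w i l) = 0}
    {S | S.IsSymm ∧ S.rank = ρ}
    (fun w S => ∀ i k l, (S.mulVec (w i k)) ⬝ᵥ (w i l) = 0) (Nat.card F - 1)
    (C * Nat.card Ω / Nat.card F ^ E) ?_ ?_
  · refine key.trans ?_
    refine (Nat.mul_le_mul_right _ (sym_count ρ E hρ hE)).trans ?_
    rw [mul_assoc, mul_assoc]
    exact Nat.mul_le_mul_left _ (Nat.mul_div_le _ _)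
  · rintro w ⟨-, S, hS, hr, hw⟩
    have hS0 : S ≠ 0 := by
      rintro rfl
      rw [Matrix.rank_zero] at hr
      omega
    refine scale_count S hS0 _ ?_
    intro u hu
    refine ⟨⟨?_, ?_⟩, ?_⟩
    · exact hS.smul u
    · rw [← hr, Matrix.rank, Matrix.rank]
      have : (u • S).mulVecLin = u • S.mulVecLin := by
        ext1 v
        ext1
        simp [Matrix.smul_mulVec]
      rw [this, LinearMap.range_smul _ _ hu]
    · intro i k l
      rw [Matrix.smul_mulVec, smul_dotProduct, hw, smul_zero]
  · rintro S ⟨hS, hr⟩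
    rw [Nat.le_div_iff_mul_le (pow_pos hq _)]
    refine le_trans (Nat.mul_le_mul_right _ ?_)
      (iso_prod h2 a ha hpair hsum ρ E h1 hρ hE S hS hr)
    exact Set.ncard_le_ncard (fun w hw => ⟨hw.1.1, hw.2⟩) (Set.toFinite _)

lemma exists_good (h2 : (2 : F) ≠ 0) {ι : Type*} [Fintype ι] [DecidableEq ι] [Nontrivial ι]
    (a : ι → ℕ) (ha : ∀ i, 1 ≤ a i) (hpair : ∀ i j, i ≠ j → a i + a j ≤ N)
    (hsum : N * (N + 1) ≤ ∑ i, a i * (a i + 1))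
    (hbig : Fintype.card (ι × ι) + N * (2 ^ N * ∏ i, ((a i + 1) * 3 ^ (a i))) < Nat.card F - 1) :
    ∃ w : (i : ι) → Fin (a i) → (Fin N → F),
      (∀ i j, i ≠ j → LinearIndependent F (Sum.elim (w i) (w j))) ∧
      ∀ S : Matrix (Fin N) (Fin N) F, S.IsSymm →
        (∀ i k l, (S.mulVec (w i k)) ⬝ᵥ (w i l) = 0) → S = 0 := by
  classical
  by_contra hcon
  push Not at hcon
  set Ω := ((i : ι) → Fin (a i) → (Fin N → F)) with hΩ
  have hpos : 0 < Nat.card Ω := Nat.card_pos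
  set C := 2 ^ N * ∏ i, ((a i + 1) * 3 ^ (a i)) with hC
  let D : ι × ι → Set Ω := fun ij => if ij.1 = ij.2 then ∅ else
    {w : Ω | ¬ LinearIndependent F (Sum.elim (w ij.1) (w ij.2))}
  let G : ℕ → Set Ω := fun ρ => {w : Ω | (∀ i, LinearIndependent F (w i)) ∧
      ∃ S : Matrix (Fin N) (Fin N) F, S.IsSymm ∧ S.rank = ρ ∧
      ∀ i k l, (S.mulVec (w i k)) ⬝ᵥ (w i l) = 0}
  have hcov : (Set.univ : Set Ω) ⊆ (⋃ ij ∈ Finset.univ (α := ι × ι), D ij) ∪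
      ⋃ ρ ∈ Finset.Icc 1 N, G ρ := by
    intro w _
    by_cases hli : ∀ i j, i ≠ j → LinearIndependent F (Sum.elim (w i) (w j))
    · right
      obtain ⟨S, hS, hw, hS0⟩ := hcon w hli
      simp only [Set.mem_iUnion]
      refine ⟨S.rank, ?_, ?_, S, hS, rfl, hw⟩
      · rw [Finset.mem_Icc]
        refine ⟨?_, ?_⟩
        · by_contra h0
          refine hS0 ?_
          have hr0 : S.rank = 0 := by omega
          rw [Matrix.rank, Submodule.finrank_eq_zero, LinearMap.range_eq_bot] at hr0
          rw [← Matrix.toLin'_apply'] at hr0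
          exact (LinearEquiv.map_eq_zero_iff _).1 hr0
        · simpa using S.rank_le_width
      · intro i
        obtain ⟨j, hj⟩ := exists_ne i
        have := (hli i j hj.symm).comp Sum.inl Sum.inl_injective
        exact this
    · left
      push Not at hli
      obtain ⟨i, j, hij, h⟩ := hli
      simp only [Set.mem_iUnion]
      refine ⟨(i, j), Finset.mem_univ _, ?_⟩
      simp only [D, if_neg hij]
      exact h
  have hD : ∀ ij, (D ij).ncard * (Nat.card F - 1) ≤ Nat.card Ω := by
    intro ij
    by_cases h : ij.1 = ij.2
    · simp [D, h]
    · simp only [D, if_neg h]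
      exact dep_count a ij.1 ij.2 h (hpair _ _ h)
  have hGc : ∀ ρ ∈ Finset.Icc 1 N, (G ρ).ncard * (Nat.card F - 1) ≤ C * Nat.card Ω := by
    intro ρ hρ
    rw [Finset.mem_Icc] at hρ
    exact iso_count_s3 h2 a ha hpair hsum ρ hρ.1 hρ.2
  have hcount : Nat.card Ω ≤ ∑ ij, (D ij).ncard + ∑ ρ ∈ Finset.Icc 1 N, (G ρ).ncard := by
    rw [← Set.ncard_univ]
    refine (Set.ncard_le_ncard hcov (Set.toFinite _)).trans ?_
    refine (Set.ncard_union_le _ _).trans ?_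
    exact Nat.add_le_add (Finset.set_ncard_biUnion_le _ _) (Finset.set_ncard_biUnion_le _ _)
  have h3 := Nat.mul_le_mul_right (Nat.card F - 1) hcount
  rw [add_mul, Finset.sum_mul, Finset.sum_mul] at h3
  have h4 := Finset.sum_le_sum (s := Finset.univ) (fun ij _ => hD ij)
  have h5 := Finset.sum_le_sum hGc
  rw [Finset.sum_const, Finset.card_univ, smul_eq_mul] at h4
  rw [Finset.sum_const, Nat.card_Icc, smul_eq_mul, Nat.add_sub_cancel] at h5
  have h6 := Nat.mul_lt_mul_of_pos_right hbig hpos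
  rw [add_mul] at h6
  rw [← mul_assoc] at h5
  rw [mul_comm (Nat.card Ω)] at h3
  omega

end Count

section Lift

/-- an integer matrix with trivial kernel mod `p` has trivial kernel over `ℂ` -/
lemma lift_ker {α β : Type*} [Fintype α] [Fintype β] (p : ℕ) [Fact p.Prime]
    (M : Matrix α β ℤ)
    (h : ∀ v : β → ZMod p, (M.map (Int.castRingHom (ZMod p))).mulVec v = 0 → v = 0)
    (v : β → ℂ) (hv : (M.map (Int.castRingHom ℂ)).mulVec v = 0) : v = 0 := by
  classical
  obtain ⟨L, hL⟩ := LinearMap.exists_leftInverse_of_injective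
    (M.map (Int.castRingHom (ZMod p))).mulVecLin
    (LinearMap.ker_eq_bot'.2 (fun v hv => h v hv))
  set L0 := LinearMap.toMatrix' L with hL0
  have hLM : L0 * (M.map (Int.castRingHom (ZMod p))) = 1 := by
    have := congrArg LinearMap.toMatrix' hL
    rw [LinearMap.toMatrix'_comp, LinearMap.toMatrix'_id] at this
    rw [← this]
    congr 1
    exact (LinearMap.toMatrix'_toLin' _).symm
  choose lft hlft using ZMod.intCast_surjective (n := p)
  set L1 : Matrix β α ℤ := L0.map lft with hL1
  have hL1' : L1.map (Int.castRingHom (ZMod p)) = L0 := by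
    ext i j
    simp [hL1, hlft]
  have hdet : (L1 * M).det ≠ 0 := by
    intro h0
    have h1 := RingHom.map_det (Int.castRingHom (ZMod p)) (L1 * M)
    rw [h0, map_zero] at h1
    have h2 : (Int.castRingHom (ZMod p)).mapMatrix (L1 * M) = 1 := by
      rw [RingHom.mapMatrix_apply, Matrix.map_mul, hL1', hLM]
    rw [h2, Matrix.det_one] at h1
    exact zero_ne_one h1
  have hdetC : ((L1 * M).map (Int.castRingHom ℂ)).det ≠ 0 := by
    have h1 := RingHom.map_det (Int.castRingHom ℂ) (L1 * M)
    rw [RingHom.mapMatrix_apply] at h1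
    rw [← h1]
    simpa using hdet
  refine Matrix.eq_zero_of_mulVec_eq_zero hdetC ?_
  rw [Matrix.map_mul, ← Matrix.mulVec_mulVec, hv, Matrix.mulVec_zero]

variable {N : ℕ}

lemma lift_li {κ : Type*} [Fintype κ] (p : ℕ) [Fact p.Prime] (w : κ → Fin N → ℤ)
    (h : LinearIndependent (ZMod p) (fun k x => ((w k x : ℤ) : ZMod p))) :
    LinearIndependent ℂ (fun k x => ((w k x : ℤ) : ℂ)) := by
  rw [Fintype.linearIndependent_iff] at h ⊢
  intro g hg i
  have := lift_ker p (Matrix.of fun (x : Fin N) (k : κ) => w k x) ?_ g ?_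
  · rw [this]; rfl
  · intro v hv
    funext i
    refine h v ?_ i
    rw [← hv]
    funext x
    simp [Matrix.mulVec, dotProduct, Finset.sum_apply, mul_comm]
  · rw [← hg]
    funext x
    simp [Matrix.mulVec, dotProduct, Finset.sum_apply, mul_comm]

/-- the matrix of the linear system for `S` -/
def sysMat {ι : Type*} (a : ι → ℕ) (w : (i : ι) → Fin (a i) → Fin N → ℤ) :
    Matrix ((Fin N × Fin N) ⊕ (Σ i, Fin (a i) × Fin (a i))) (Fin N × Fin N) ℤ :=
  Matrix.of fun r c => match r with
    | Sum.inl xy => (if c = xy then 1 else 0) - (if c = (xy.2, xy.1) then 1 else 0)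
    | Sum.inr t => w t.1 t.2.1 c.2 * w t.1 t.2.2 c.1

lemma sysMat_iff {ι : Type*} [Fintype ι] (a : ι → ℕ)
    (w : (i : ι) → Fin (a i) → Fin N → ℤ) {K : Type*} [CommRing K] (v : Fin N × Fin N → K) :
    ((sysMat a w).map (Int.castRingHom K)).mulVec v = 0 ↔
      (Matrix.of fun x y => v (x, y)).IsSymm ∧
      ∀ i k l, (Matrix.mulVec (Matrix.of fun x y => v (x, y)) (fun x => (w i k x : K))) ⬝ᵥ
        (fun x => (w i l x : K)) = 0 := by
  rw [funext_iff, Sum.forall]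
  refine and_congr ?_ ?_
  · rw [Matrix.IsSymm.ext_iff]
    simp only [Prod.forall]
    rw [forall_comm]
    refine forall_congr' fun x => forall_congr' fun y => ?_
    simp [Matrix.mulVec, dotProduct, sysMat, sub_mul, Finset.sum_sub_distrib, sub_eq_zero]
  · simp only [Sigma.forall, Prod.forall]
    refine forall_congr' fun i => forall_congr' fun k => forall_congr' fun l => ?_
    have : ((sysMat a w).map (Int.castRingHom K)).mulVec v (Sum.inr ⟨i, k, l⟩) =
       (Matrix.mulVec (Matrix.of fun x y => v (x, y)) (fun x => (w i k x : K))) ⬝ᵥ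
        (fun x => (w i l x : K)) := by
      simp only [Matrix.mulVec, dotProduct, sysMat, Fintype.sum_prod_type, Finset.sum_mul,
        Matrix.map_apply, Matrix.of_apply]
      refine Finset.sum_congr rfl fun x _ => Finset.sum_congr rfl fun y _ => ?_
      simp
      ring
    rw [this]
    rfl

lemma exists_complex {ι : Type*} [Fintype ι] [DecidableEq ι] [Nontrivial ι]
    (a : ι → ℕ) (ha : ∀ i, 1 ≤ a i) (hpair : ∀ i j, i ≠ j → a i + a j ≤ N)
    (hsum : N * (N + 1) ≤ ∑ i, a i * (a i + 1)) :
    ∃ w : (i : ι) → Fin (a i) → (Fin N → ℂ),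
      (∀ i j, i ≠ j → LinearIndependent ℂ (Sum.elim (w i) (w j))) ∧
      ∀ S : Matrix (Fin N) (Fin N) ℂ, S.IsSymm →
        (∀ i k l, (S.mulVec (w i k)) ⬝ᵥ (w i l) = 0) → S = 0 := by
  classical
  obtain ⟨p, hp, hprime⟩ := Nat.exists_infinite_primes
    (Fintype.card (ι × ι) + N * (2 ^ N * ∏ i, ((a i + 1) * 3 ^ (a i))) + 3)
  have : Fact p.Prime := ⟨hprime⟩
  have h2 : (2 : ZMod p) ≠ 0 := by
    intro h
    have h' : ((2 : ℕ) : ZMod p) = 0 := by exact_mod_cast h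
    rw [ZMod.natCast_eq_zero_iff] at h'
    have := Nat.le_of_dvd (by norm_num) h'
    omega
  obtain ⟨w, hli, hw⟩ := exists_good (F := ZMod p) (N := N) h2 a ha hpair hsum
    (by rw [Nat.card_zmod]; omega)
  choose lft hlft using ZMod.intCast_surjective (n := p)
  have hcast : ∀ i, w i = fun k x => ((lft (w i k x) : ℤ) : ZMod p) := by
    intro i; funext k x; rw [hlft]
  refine ⟨fun i k x => ((lft (w i k x) : ℤ) : ℂ), ?_, ?_⟩
  · intro i j hij
    have h1 := lift_li p (Sum.elim (fun k x => lft (w i k x)) (fun k x => lft (w j k x))) ?_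
    · convert h1 using 1
      funext k
      rcases k with k | k <;> rfl
    · convert hli i j hij using 1
      funext k x
      rcases k with k | k <;> simp [hlft]
  · intro S hS hSw
    have h1 := lift_ker p (sysMat a (fun i k x => lft (w i k x))) ?_ (fun xy => S xy.1 xy.2) ?_
    · ext x y
      exact congrFun h1 (x, y)
    · intro v hv
      rw [sysMat_iff] at hv
      have h0 := hw _ hv.1 (fun i k l => by
        have := hv.2 i k l
        simp only [hlft] at this
        exact this)
      funext ⟨x, y⟩
      exact congrFun (congrFun h0 x) y
    · rw [sysMat_iff]
      exact ⟨hS, hSw⟩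

end Lift

/-- If the configuration is "too big" (`Σ C(m_i+2,2) ≥ C(n+2,2)`), a generic configuration
of pairwise disjoint linear spaces of weight vector `(m_1, …, m_s)` lies on no quadric.
(`m` is 1-indexed: the components are `m 1, …, m s`.) -/
theorem stmt3 (n s : ℕ) (m : ℕ → ℕ) (hs : 2 ≤ s)
    (hmono : ∀ i j, 1 ≤ i → i ≤ j → j ≤ s → m j ≤ m i)
    (h12 : m 1 + m 2 < n)
    (hsum : (n + 2).choose 2 ≤ ∑ i ∈ Finset.Icc 1 s, (m i + 2).choose 2) :
    ∃ W : ℕ → Submodule ℂ (Fin (n + 1) → ℂ),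
      (∀ i ∈ Finset.Icc 1 s, Module.finrank ℂ (W i) = m i + 1) ∧
      (∀ i ∈ Finset.Icc 1 s, ∀ j ∈ Finset.Icc 1 s, i ≠ j → W i ⊓ W j = ⊥) ∧
      ∀ q : QuadraticForm ℂ (Fin (n + 1) → ℂ),
        (∀ i ∈ Finset.Icc 1 s, ∀ v ∈ W i, q v = 0) → q = 0 := by
  classical
  have hnt : Nontrivial {i // i ∈ Finset.Icc 1 s} :=
    ⟨⟨1, by simp; omega⟩, ⟨2, by simp; omega⟩, by simp⟩
  have hlt : ∀ i ∈ Finset.Icc 1 s, ∀ j ∈ Finset.Icc 1 s, i < j → m i + 1 + (m j + 1) ≤ n + 1 := by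
    intro i hi j hj hij
    rw [Finset.mem_Icc] at hi hj
    have h1 := hmono 1 i le_rfl hi.1 hi.2
    have h2 := hmono 2 j (by norm_num) (by omega) hj.2
    omega
  have hT : ∀ k : ℕ, (k + 2).choose 2 * 2 = (k + 1) * (k + 1 + 1) := by
    intro k
    rw [Nat.choose_two_right, Nat.div_mul_cancel (Nat.even_mul_pred_self (k + 2)).two_dvd]
    exact mul_comm _ _
  obtain ⟨w, hli, hw⟩ := exists_complex (N := n + 1) (ι := {i // i ∈ Finset.Icc 1 s})
    (fun i => m i.1 + 1) (fun i => by omega)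
    (by
      rintro ⟨i, hi⟩ ⟨j, hj⟩ hij
      have hij' : i ≠ j := fun h => hij (Subtype.ext h)
      rcases lt_or_gt_of_ne hij' with h | h
      · exact hlt i hi j hj h
      · have := hlt j hj i hi h
        simp only
        omega)
    (by
      have h1 := Nat.mul_le_mul_right 2 hsum
      rw [hT, Finset.sum_mul] at h1
      refine h1.trans (le_of_eq ?_)
      rw [← Finset.sum_coe_sort]
      exact Finset.sum_congr rfl fun i _ => hT _)
  have hli1 : ∀ i, LinearIndependent ℂ (w i) := by
    intro i
    obtain ⟨j, hj⟩ := exists_ne i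
    exact (hli i j hj.symm).comp Sum.inl Sum.inl_injective
  let W : ℕ → Submodule ℂ (Fin (n + 1) → ℂ) := fun i =>
    if h : i ∈ Finset.Icc 1 s then Submodule.span ℂ (Set.range (w ⟨i, h⟩)) else ⊥
  have hW : ∀ i (h : i ∈ Finset.Icc 1 s), W i = Submodule.span ℂ (Set.range (w ⟨i, h⟩)) :=
    fun i h => dif_pos h
  refine ⟨W, ?_, ?_, ?_⟩
  · intro i hi
    rw [hW i hi, finrank_span_eq_card (hli1 _), Fintype.card_fin]
  · intro i hi j hj hij
    rw [hW i hi, hW j hj, ← disjoint_iff]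
    have := hli ⟨i, hi⟩ ⟨j, hj⟩ (fun h => hij (congrArg Subtype.val h))
    exact (linearIndependent_sum.1 this).2.2
  · intro q hq
    let S : Matrix (Fin (n + 1)) (Fin (n + 1)) ℂ := Matrix.of fun x y =>
      q.polarBilin (Pi.single x 1) (Pi.single y 1)
    have hpol : ∀ u v, (S.mulVec u) ⬝ᵥ v = QuadraticMap.polar q u v := by
      intro u v
      have h1 : QuadraticMap.polar q u v = q.polarBilin v u := by
        rw [QuadraticMap.polarBilin_apply_apply, QuadraticMap.polar_comm]
      rw [h1, dotProduct_comm]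
      have h2 : S = LinearMap.toMatrix₂' ℂ q.polarBilin := by
        ext x y
        simp [S, LinearMap.toMatrix₂'_apply]
      rw [h2, ← Matrix.toLinearMap₂'_apply', Matrix.toLinearMap₂'_toMatrix']
    have hS : S = 0 := by
      refine hw S ?_ ?_
      · ext x y
        simp [S, QuadraticMap.polar_comm]
      · intro i k l
        rw [hpol]
        have hk : w i k ∈ W i.1 := by rw [hW i.1 i.2]; exact Submodule.subset_span ⟨k, rfl⟩
        have hl : w i l ∈ W i.1 := by rw [hW i.1 i.2]; exact Submodule.subset_span ⟨l, rfl⟩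
        rw [QuadraticMap.polar, hq _ i.2 _ hk, hq _ i.2 _ hl, hq _ i.2 _ (Submodule.add_mem _ hk hl)]
        simp
    ext v
    have h1 := hpol v v
    rw [hS, Matrix.zero_mulVec, zero_dotProduct, QuadraticMap.polar_self] at h1
    have : (2 : ℂ) * q v = 0 := by rw [h1]; simp
    simpa using this
end
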